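/- arXiv:1810.04558 — 3 statements merged into one kernel-verified Lean document; each statement's English description precedes it below -/
import Mathlib

section
/- (Gallagher) Let k ≥ 2 and let ψ : ℕ → ℝ_{≥0} be a decreasing function. Let W_k^×(ψ) be the set of (α_1, …, α_k) ∈ [0,1]^k such that ‖nα_1‖ ⋯ ‖nα_k‖ < ψ(n) has infinitely many solutions n ∈ ℕ. Then the k-dimensional Lebesgue measure of W_k^×(ψ) equals 0 if Σ_{n=1}^∞ ψ(n)(log n)^{k−1} < ∞, and equals 1 if Σ_{n=1}^∞ ψ(n)(log n)^{k−1} = ∞. -/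
open scoped BigOperators
open Filter MeasureTheory

/-- Distance from `x` to the nearest integer. -/
noncomputable def dn (x : ℝ) : ℝ := |x - round x|

lemma sum_prime_inv_sq_le (M : ℕ) :
    ∑ p ∈ (Finset.range M).filter Nat.Prime, (1 : ℝ) / (p : ℝ) ^ 2 ≤ 1 / 2 := by
  have key : ∀ i : ℕ, ∑ p ∈ (Finset.range (2 * i + 3)).filter Nat.Prime, (1 : ℝ) / (p : ℝ) ^ 2
      ≤ 1 / 2 - 1 / (4 * (i + 1)) := by
    intro i
    induction i with
    | zero =>
      have : (Finset.range (2 * 0 + 3)).filter Nat.Prime = {2} := by decide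
      rw [this]; norm_num
    | succ i ih =>
      have h4 : ¬ Nat.Prime (2 * i + 4) := by
        intro h
        have := (Nat.prime_dvd_prime_iff_eq Nat.prime_two h).1 ⟨i + 2, by ring⟩
        omega
      rw [show 2 * (i + 1) + 3 = (2 * i + 3) + 1 + 1 by ring, Finset.range_add_one,
        Finset.filter_insert, if_neg (by simpa using h4), Finset.range_add_one,
        Finset.filter_insert]
      have hb : (1 : ℝ) / ((2 * i + 3 : ℕ) : ℝ) ^ 2
          ≤ 1 / (4 * (i + 1)) - 1 / (4 * ((i + 1 : ℕ) + 1)) := by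
        push_cast
        rw [div_sub_div _ _ (by positivity) (by positivity), div_le_div_iff₀ (by positivity)
          (by positivity)]
        have : (0 : ℝ) ≤ i := by positivity
        nlinarith [mul_nonneg this this]
      split_ifs
      · rw [Finset.sum_insert (by simp)]
        linarith
      · have : (0 : ℝ) ≤ 1 / ((2 * i + 3 : ℕ) : ℝ) ^ 2 := by positivity
        linarith
  refine le_trans ?_ ((key M).trans (sub_le_self _ (by positivity)))
  refine Finset.sum_le_sum_of_subset_of_nonneg ?_ fun _ _ _ => by positivity
  exact Finset.filter_subset_filter _ (Finset.range_mono (by omega))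

lemma one_sub_sum_le_prod {ι : Type*} (s : Finset ι) (f : ι → ℝ) (h0 : ∀ i ∈ s, 0 ≤ f i)
    (h1 : ∀ i ∈ s, f i ≤ 1) : 1 - ∑ i ∈ s, f i ≤ ∏ i ∈ s, (1 - f i) := by
  classical
  induction s using Finset.induction_on with
  | empty => simp
  | insert a s ha ih =>
    rw [Finset.sum_insert ha, Finset.prod_insert ha]
    have ih' := ih (fun i hi => h0 i (Finset.mem_insert_of_mem hi))
      (fun i hi => h1 i (Finset.mem_insert_of_mem hi))
    have ha0 := h0 a (Finset.mem_insert_self _ _)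
    have ha1 := h1 a (Finset.mem_insert_self _ _)
    have hs : 0 ≤ ∑ i ∈ s, f i :=
      Finset.sum_nonneg fun i hi => h0 i (Finset.mem_insert_of_mem hi)
    nlinarith [mul_nonneg ha0 hs, mul_le_mul_of_nonneg_left ih' (sub_nonneg.2 ha1)]

lemma one_sub_sum_inv_le_totient_div {n : ℕ} (hn : 0 < n) :
    1 - ∑ p ∈ n.primeFactors, (1 : ℝ) / p ≤ (n.totient : ℝ) / n := by
  have h := Nat.totient_eq_mul_prod_factors n
  have h' : (n.totient : ℝ) = n * ∏ p ∈ n.primeFactors, (1 - (p : ℝ)⁻¹) := by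
    have h2 := congrArg (Rat.cast : ℚ → ℝ) h
    push_cast at h2
    exact h2
  rw [h', mul_div_cancel_left₀ _ (by positivity)]
  simp only [one_div]
  refine one_sub_sum_le_prod _ _ (fun i _ => by positivity) fun i hi => ?_
  exact inv_le_one_of_one_le₀ (by exact_mod_cast (Nat.prime_of_mem_primeFactors hi).one_le)

lemma half_le_sum_totient_div (M : ℕ) :
    (M : ℝ) / 2 ≤ ∑ n ∈ Finset.Ioc 0 M, (n.totient : ℝ) / n := by
  have h1 : ∑ n ∈ Finset.Ioc 0 M, (1 - ∑ p ∈ n.primeFactors, (1 : ℝ) / p)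
      ≤ ∑ n ∈ Finset.Ioc 0 M, (n.totient : ℝ) / n :=
    Finset.sum_le_sum fun n hn => one_sub_sum_inv_le_totient_div (Finset.mem_Ioc.1 hn).1
  refine le_trans ?_ h1
  have h2 : ∑ n ∈ Finset.Ioc 0 M, ∑ p ∈ n.primeFactors, (1 : ℝ) / p
      = ∑ p ∈ (Finset.range (M + 1)).filter Nat.Prime,
          ∑ _n ∈ (Finset.Ioc 0 M).filter (p ∣ ·), (1 : ℝ) / p := by
    refine Finset.sum_comm' fun n p => ?_
    simp only [Finset.mem_Ioc, Nat.mem_primeFactors, Finset.mem_filter, Finset.mem_range]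
    constructor
    · rintro ⟨⟨h0, hM⟩, hp, hd, -⟩
      exact ⟨⟨⟨h0, hM⟩, hd⟩, by have := Nat.le_of_dvd h0 hd; omega, hp⟩
    · rintro ⟨⟨⟨h0, hM⟩, hd⟩, -, hp⟩
      exact ⟨⟨h0, hM⟩, hp, hd, h0.ne'⟩
  have h3 : ∑ p ∈ (Finset.range (M + 1)).filter Nat.Prime,
      ∑ _n ∈ (Finset.Ioc 0 M).filter (p ∣ ·), (1 : ℝ) / p
      ≤ ∑ p ∈ (Finset.range (M + 1)).filter Nat.Prime, (M : ℝ) * (1 / (p : ℝ) ^ 2) := by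
    refine Finset.sum_le_sum fun p hp => ?_
    rw [Finset.sum_const, Nat.Ioc_filter_dvd_card_eq_div, nsmul_eq_mul]
    have hp0 : (0 : ℝ) < p := by exact_mod_cast (Finset.mem_filter.1 hp).2.pos
    calc ((M / p : ℕ) : ℝ) * (1 / p) ≤ (M / p : ℝ) * (1 / p) := by
          gcongr; exact Nat.cast_div_le
      _ = _ := by field_simp
  rw [Finset.sum_sub_distrib, h2]
  rw [← Finset.mul_sum] at h3
  have h4 := mul_le_mul_of_nonneg_left (sum_prime_inv_sq_le (M + 1)) (Nat.cast_nonneg (α := ℝ) M)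
  rw [Finset.sum_const, Nat.card_Ioc, nsmul_eq_mul, mul_one, tsub_zero]
  linarith

/-- A positive proportion of the integers of `(N, 4N]` have a large totient. -/
lemma half_le_card_large_totient (N : ℕ) :
    (N : ℝ) / 2 ≤ (((Finset.Ioc N (4 * N)).filter
      fun n : ℕ => (n : ℝ) / 6 ≤ n.totient).card : ℝ) := by
  have h1 := half_le_sum_totient_div (4 * N)
  have hle : ∀ n : ℕ, (n.totient : ℝ) / n ≤ 1 := fun n =>
    div_le_one_of_le₀ (by exact_mod_cast n.totient_le) (by positivity)
  have h2 : ∑ n ∈ Finset.Ioc 0 N, (n.totient : ℝ) / n ≤ N := by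
    refine (Finset.sum_le_sum fun n _ => hle n).trans ?_
    simp
  have h3 : ∑ n ∈ Finset.Ioc 0 (4 * N), (n.totient : ℝ) / n
      = ∑ n ∈ Finset.Ioc 0 N, (n.totient : ℝ) / n
        + ∑ n ∈ Finset.Ioc N (4 * N), (n.totient : ℝ) / n := by
    rw [Finset.sum_Ioc_consecutive _ (Nat.zero_le _) (by omega)]
  have h4 : ∑ n ∈ Finset.Ioc N (4 * N), (n.totient : ℝ) / n
      ≤ ∑ n ∈ Finset.Ioc N (4 * N),
        ((if (n : ℝ) / 6 ≤ n.totient then (1 : ℝ) else 0) + 1 / 6) := by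
    refine Finset.sum_le_sum fun n hn => ?_
    have hn0 : (0 : ℝ) < n := by
      have := (Finset.mem_Ioc.1 hn).1
      exact_mod_cast (Nat.zero_le _).trans_lt this
    split_ifs with h
    · linarith [hle n]
    · rw [zero_add, div_le_iff₀ hn0]
      linarith [not_le.1 h]
  rw [Finset.sum_add_distrib, Finset.sum_boole, Finset.sum_const, Nat.card_Ioc, nsmul_eq_mul,
    show 4 * N - N = 3 * N by omega] at h4
  push_cast at *
  linarith

/-- Reduced fractions `a / n` and `b / m` with different denominators are rarely close. -/
lemma card_close_reduced_fractions_le {n m : ℕ} (hn : 0 < n) (hm : 0 < m) (hnm : n ≠ m) (X : ℝ)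
    (hX : 0 ≤ X) :
    ((((Finset.range n ×ˢ Finset.range m).filter fun q =>
      n.Coprime q.1 ∧ m.Coprime q.2 ∧ |(q.1 : ℝ) * m - q.2 * n| < X).card : ℕ) : ℝ) ≤ 2 * X := by
  obtain ⟨g, n', m', hg, hcop, rfl, rfl⟩ := Nat.exists_coprime' (m := n) (n := m)
    (Nat.gcd_pos_of_pos_left _ hn)
  have hn' : 0 < n' := Nat.pos_of_mul_pos_right hn
  have hgR : (0 : ℝ) < g := by exact_mod_cast hg
  set P := (Finset.range (n' * g) ×ˢ Finset.range (m' * g)).filter fun q =>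
      (n' * g).Coprime q.1 ∧ (m' * g).Coprime q.2 ∧
        |(q.1 : ℝ) * (m' * g : ℕ) - q.2 * (n' * g : ℕ)| < X with hP
  set L := ⌊X / g⌋₊ with hL
  let f : ℕ × ℕ → ℤ × ℕ := fun q => ((q.1 : ℤ) * m' - q.2 * n', q.1 / n')
  have hmaps : ∀ q ∈ P, f q ∈ ((Finset.Icc (-(L : ℤ)) L).erase 0) ×ˢ Finset.range g := by
    rintro ⟨a, b⟩ hq
    simp only [hP, Finset.mem_filter, Finset.mem_product, Finset.mem_range] at hq
    obtain ⟨⟨ha, hb⟩, hca, hcb, hlt⟩ := hq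
    simp only [f, Finset.mem_product, Finset.mem_erase, Finset.mem_Icc, Finset.mem_range]
    refine ⟨⟨?_, ?_⟩, ?_⟩
    · intro h0
      have h0' : a * m' = b * n' := by exact_mod_cast sub_eq_zero.1 h0
      apply hnm
      apply Nat.dvd_antisymm
      · refine hca.dvd_of_dvd_mul_left ⟨b, ?_⟩
        calc a * (m' * g) = (a * m') * g := by ring
          _ = _ := by rw [h0']; ring
      · refine hcb.dvd_of_dvd_mul_left ⟨a, ?_⟩
        calc b * (n' * g) = (b * n') * g := by ring
          _ = _ := by rw [← h0']; ring
    · rw [← abs_le]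
      have : |(a : ℝ) * m' - b * n'| < X / g := by
        rw [lt_div_iff₀ hgR]
        nth_rewrite 1 [← abs_of_pos hgR]
        rw [← abs_mul]
        have e : ((a : ℝ) * m' - b * n') * g = a * (m' * g : ℕ) - b * (n' * g : ℕ) := by
          push_cast; ring
        rw [e]
        exact hlt
      have h2 : (((a : ℤ) * m' - b * n').natAbs : ℝ) < X / g := by
        rw [Nat.cast_natAbs]; push_cast; exact this
      have h3 : ((a : ℤ) * m' - b * n').natAbs ≤ L := Nat.le_floor h2.le
      rw [Int.abs_eq_natAbs]
      exact_mod_cast h3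
    · exact Nat.div_lt_of_lt_mul ha
  have hinj : Set.InjOn f P := by
    rintro ⟨a, b⟩ - ⟨a', b'⟩ - h
    simp only [f, Prod.mk.injEq] at h
    obtain ⟨h1, h2⟩ := h
    have h3 : ((a : ℤ) - a') * m' = (b - b') * n' := by linarith
    have h4 : (n' : ℤ) ∣ (a : ℤ) - a' := by
      have : IsCoprime (n' : ℤ) (m' : ℤ) := Nat.isCoprime_iff_coprime.2 hcop
      exact this.dvd_of_dvd_mul_right (h3 ▸ dvd_mul_left _ _)
    have h5 : a % n' = a' % n' := by
      exact (Nat.modEq_iff_dvd.2 h4).symm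
    have h6 : a = a' := by
      rw [← Nat.div_add_mod a n', ← Nat.div_add_mod a' n', h2, h5]
    subst h6
    have h7 : ((b : ℤ) - b') * n' = 0 := by rw [← h3]; ring
    have h8 : (b : ℤ) - b' = 0 := (mul_eq_zero.1 h7).resolve_right (by exact_mod_cast hn'.ne')
    have : b = b' := by omega
    rw [this]
  have hcard := Finset.card_le_card_of_injOn f hmaps hinj
  rw [Finset.card_product, Finset.card_range, Finset.card_erase_of_mem (by simp),
    Int.card_Icc] at hcard
  have h9 : (((L : ℤ) + 1 - -(L : ℤ)).toNat - 1) = 2 * L := by omega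
  rw [h9] at hcard
  have h10 : (L : ℝ) ≤ X / g := Nat.floor_le (by positivity)
  calc ((P.card : ℕ) : ℝ) ≤ ((2 * L * g : ℕ) : ℝ) := by exact_mod_cast hcard
    _ = 2 * L * g := by push_cast; ring
    _ ≤ 2 * (X / g) * g := by gcongr
    _ = 2 * X := by field_simp

/-- Points of `[0, 1)` whose `n`-th multiple lies in a dyadic annulus to the right of an integer
coprime to `n`. -/
def reducedAnnulus (n r : ℕ) : Set ℝ :=
  ⋃ a ∈ (Finset.range n).filter n.Coprime,
    Set.Ico (((a : ℝ) + (1 / 2) ^ (r + 1)) / n) (((a : ℝ) + (1 / 2) ^ r) / n)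

lemma mem_reducedAnnulus {n r : ℕ} (hn : 0 < n) {x : ℝ} :
    x ∈ reducedAnnulus n r ↔ ∃ a : ℕ, a < n ∧ n.Coprime a ∧
      (a : ℝ) + (1 / 2) ^ (r + 1) ≤ n * x ∧ n * x < a + (1 / 2) ^ r := by
  have hn' : (0 : ℝ) < n := by exact_mod_cast hn
  simp only [reducedAnnulus, Set.mem_iUnion, Finset.mem_filter, Finset.mem_range, Set.mem_Ico,
    exists_prop, div_le_iff₀ hn', lt_div_iff₀ hn', and_assoc, mul_comm x]

lemma reducedAnnulus_subset {n r : ℕ} (hn : 0 < n) :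
    reducedAnnulus n r ⊆ Set.Icc 0 1 := by
  intro x hx
  obtain ⟨a, ha, -, h1, h2⟩ := (mem_reducedAnnulus hn).1 hx
  have hn' : (0 : ℝ) < n := by exact_mod_cast hn
  have h3 : (1 / 2 : ℝ) ^ r ≤ 1 := pow_le_one₀ (by norm_num) (by norm_num)
  have h4 : (0 : ℝ) < (1 / 2 : ℝ) ^ (r + 1) := by positivity
  have h5 : (a : ℝ) + 1 ≤ n := by exact_mod_cast ha
  have h6 : (0 : ℝ) ≤ a := by positivity
  constructor
  · by_contra h
    nlinarith [not_le.1 h]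
  · by_contra h
    nlinarith [not_le.1 h]

lemma measurableSet_reducedAnnulus (n r : ℕ) : MeasurableSet (reducedAnnulus n r) :=
  Finset.measurableSet_biUnion _ fun _ _ => measurableSet_Ico

lemma eq_of_mem_Ico_nat {a b : ℕ} {y : ℝ} (ha : (a : ℝ) ≤ y) (ha' : y < a + 1)
    (hb : (b : ℝ) ≤ y) (hb' : y < b + 1) : a = b := by
  have h1 : (a : ℝ) < b + 1 := by linarith
  have h2 : (b : ℝ) < a + 1 := by linarith
  have h1' : a < b + 1 := by exact_mod_cast h1
  have h2' : b < a + 1 := by exact_mod_cast h2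
  omega

lemma volume_reducedAnnulus {n : ℕ} (hn : 0 < n) (r : ℕ) :
    volume (reducedAnnulus n r)
      = ENNReal.ofReal ((n.totient : ℝ) / n * (1 / 2) ^ (r + 1)) := by
  have hn' : (0 : ℝ) < n := by exact_mod_cast hn
  have h3 : (1 / 2 : ℝ) ^ r ≤ 1 := pow_le_one₀ (by norm_num) (by norm_num)
  have h4 : (0 : ℝ) < (1 / 2 : ℝ) ^ (r + 1) := by positivity
  rw [reducedAnnulus, measure_biUnion_finset ?_ fun _ _ => measurableSet_Ico]
  · simp only [Real.volume_Ico]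
    have : ∀ a : ℕ, ((a : ℝ) + (1 / 2) ^ r) / n - ((a : ℝ) + (1 / 2) ^ (r + 1)) / n
        = (1 / 2) ^ (r + 1) / n := by
      intro a; rw [pow_succ]; ring
    simp only [this, Finset.sum_const, nsmul_eq_mul]
    rw [← ENNReal.ofReal_natCast, ← ENNReal.ofReal_mul (by positivity)]
    congr 1
    rw [Nat.totient]
    ring
  · intro a _ b _ hab
    refine Set.disjoint_left.2 fun x hxa hxb => hab ?_
    rw [Set.mem_Ico, div_le_iff₀ hn', lt_div_iff₀ hn'] at hxa hxb
    exact eq_of_mem_Ico_nat (y := x * n) (by linarith) (by linarith) (by linarith) (by linarith)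

lemma disjoint_reducedAnnulus {n r s : ℕ} (hn : 0 < n) (hrs : r ≠ s) :
    Disjoint (reducedAnnulus n r) (reducedAnnulus n s) := by
  wlog h : r < s generalizing r s
  · exact (this hrs.symm (by omega)).symm
  refine Set.disjoint_left.2 fun x hx hy => ?_
  obtain ⟨a, -, -, h1, h2⟩ := (mem_reducedAnnulus hn).1 hx
  obtain ⟨b, -, -, h3, h4⟩ := (mem_reducedAnnulus hn).1 hy
  have hr : (1 / 2 : ℝ) ^ r ≤ 1 := pow_le_one₀ (by norm_num) (by norm_num)
  have hs : (1 / 2 : ℝ) ^ s ≤ 1 := pow_le_one₀ (by norm_num) (by norm_num)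
  have hr' : (0 : ℝ) < (1 / 2 : ℝ) ^ (r + 1) := by positivity
  have hs' : (0 : ℝ) < (1 / 2 : ℝ) ^ (s + 1) := by positivity
  have hab : a = b :=
    eq_of_mem_Ico_nat (y := n * x) (by linarith) (by linarith) (by linarith) (by linarith)
  subst hab
  have : (1 / 2 : ℝ) ^ s ≤ (1 / 2) ^ (r + 1) :=
    pow_le_pow_of_le_one (by norm_num) (by norm_num) h
  linarith

lemma dn_le (x : ℝ) (z : ℤ) : dn x ≤ |x - z| := round_le x z

lemma dn_nonneg (x : ℝ) : 0 ≤ dn x := abs_nonneg _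

lemma dn_lt_of_mem_reducedAnnulus {n r : ℕ} (hn : 0 < n) {x : ℝ} (hx : x ∈ reducedAnnulus n r) :
    dn (n * x) < (1 / 2) ^ r := by
  obtain ⟨a, -, -, h1, h2⟩ := (mem_reducedAnnulus hn).1 hx
  have h4 : (0 : ℝ) < (1 / 2 : ℝ) ^ (r + 1) := by positivity
  refine (dn_le _ a).trans_lt ?_
  push_cast
  rw [abs_lt]
  constructor <;> linarith

lemma volume_reducedAnnulus_inter_le {n m : ℕ} (hn : 0 < n) (hm : 0 < m) (hnm : n ≠ m)
    (r s : ℕ) :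
    volume (reducedAnnulus n r ∩ reducedAnnulus m s)
      ≤ ENNReal.ofReal (2 * (1 / 2) ^ r * (1 / 2) ^ s) := by
  have hn' : (0 : ℝ) < n := by exact_mod_cast hn
  have hm' : (0 : ℝ) < m := by exact_mod_cast hm
  set δ : ℝ := (1 / 2) ^ r with hδ
  set ε : ℝ := (1 / 2) ^ s with hε
  have hδ0 : 0 < δ := by positivity
  have hε0 : 0 < ε := by positivity
  set X : ℝ := max (δ * m) (ε * n) with hX
  have hX0 : 0 ≤ X := le_max_of_le_left (by positivity)
  set P := (Finset.range n ×ˢ Finset.range m).filter fun q =>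
      n.Coprime q.1 ∧ m.Coprime q.2 ∧ |(q.1 : ℝ) * m - q.2 * n| < X with hP
  have hsub : reducedAnnulus n r ∩ reducedAnnulus m s ⊆ ⋃ q ∈ P,
      (Set.Ico ((q.1 : ℝ) / n) ((q.1 : ℝ) / n + δ / n) ∩
        Set.Ico ((q.2 : ℝ) / m) ((q.2 : ℝ) / m + ε / m)) := by
    rintro x ⟨hx, hy⟩
    obtain ⟨a, ha, hca, h1, h2⟩ := (mem_reducedAnnulus hn).1 hx
    obtain ⟨b, hb, hcb, h3, h4⟩ := (mem_reducedAnnulus hm).1 hy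
    have hr' : (0 : ℝ) < (1 / 2 : ℝ) ^ (r + 1) := by positivity
    have hs' : (0 : ℝ) < (1 / 2 : ℝ) ^ (s + 1) := by positivity
    simp only [Set.mem_iUnion, exists_prop]
    refine ⟨(a, b), ?_, ?_⟩
    · simp only [hP, Finset.mem_filter, Finset.mem_product, Finset.mem_range]
      refine ⟨⟨ha, hb⟩, hca, hcb, ?_⟩
      have h5 : (0 : ℝ) < n * x - a := by linarith
      have h6 : n * x - a < δ := by linarith
      have h7 : (0 : ℝ) < m * x - b := by linarith
      have h8 : m * x - b < ε := by linarith
      have e : (a : ℝ) * m - b * n = (m * x - b) * n - (n * x - a) * m := by ring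
      rw [e, abs_lt]
      have := mul_lt_mul_of_pos_right h6 hm'
      have := mul_lt_mul_of_pos_right h8 hn'
      have := mul_pos h5 hm'
      have := mul_pos h7 hn'
      have := le_max_left (δ * m) (ε * n)
      have := le_max_right (δ * m) (ε * n)
      constructor <;> linarith
    · simp only [Set.mem_inter_iff, Set.mem_Ico, ← add_div, div_le_iff₀ hn', lt_div_iff₀ hn',
        div_le_iff₀ hm', lt_div_iff₀ hm']
      refine ⟨⟨?_, ?_⟩, ?_, ?_⟩ <;> linarith
  have hone : ∀ q ∈ P, volume (Set.Ico ((q.1 : ℝ) / n) ((q.1 : ℝ) / n + δ / n) ∩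
        Set.Ico ((q.2 : ℝ) / m) ((q.2 : ℝ) / m + ε / m))
      ≤ ENNReal.ofReal (min (δ / n) (ε / m)) := by
    intro q _
    rw [ENNReal.ofReal_min]
    refine le_min ((measure_mono Set.inter_subset_left).trans ?_)
      ((measure_mono Set.inter_subset_right).trans ?_) <;> simp
  calc volume (reducedAnnulus n r ∩ reducedAnnulus m s)
      ≤ ∑ q ∈ P, ENNReal.ofReal (min (δ / n) (ε / m)) :=
        (measure_mono hsub).trans ((measure_biUnion_finset_le _ _).trans (Finset.sum_le_sum hone))
    _ = ENNReal.ofReal (P.card * min (δ / n) (ε / m)) := by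
        rw [Finset.sum_const, nsmul_eq_mul, ← ENNReal.ofReal_natCast,
          ← ENNReal.ofReal_mul (by positivity)]
    _ ≤ ENNReal.ofReal (2 * δ * ε) := by
        refine ENNReal.ofReal_le_ofReal ?_
        have hc := card_close_reduced_fractions_le hn hm hnm X hX0
        have hmin : 0 ≤ min (δ / n) (ε / m) := le_min (by positivity) (by positivity)
        calc (P.card : ℝ) * min (δ / n) (ε / m) ≤ 2 * X * min (δ / n) (ε / m) := by gcongr
          _ = 2 * (X * min (δ / n) (ε / m)) := by ring
          _ ≤ 2 * (δ * ε) := by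
            refine mul_le_mul_of_nonneg_left ?_ (by norm_num)
            rcases max_cases (δ * m) (ε * n) with ⟨h, -⟩ | ⟨h, -⟩
            · rw [hX, h]
              calc δ * m * min (δ / n) (ε / m) ≤ δ * m * (ε / m) := by
                    gcongr; exact min_le_right _ _
                _ = _ := by field_simp
            · rw [hX, h]
              calc ε * n * min (δ / n) (ε / m) ≤ ε * n * (δ / n) := by
                    gcongr; exact min_le_left _ _
                _ = _ := by field_simp
          _ = _ := by ring

lemma card_antidiagonalTuple_le (k R : ℕ) :
    (Finset.Nat.antidiagonalTuple (k + 1) R).card ≤ (R + 1) ^ k := by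
  have h := Finset.card_le_card_of_injOn (s := Finset.Nat.antidiagonalTuple (k + 1) R)
    (t := Fintype.piFinset fun _ : Fin k => Finset.range (R + 1)) (Fin.tail) ?_ ?_
  · simpa using h
  · intro r hr
    rw [Finset.mem_coe, Finset.Nat.mem_antidiagonalTuple] at hr
    simp only [Finset.mem_coe, Fintype.mem_piFinset, Finset.mem_range, Nat.lt_succ_iff]
    intro i
    rw [← hr]
    exact Finset.single_le_sum (f := r) (fun _ _ => Nat.zero_le _) (Finset.mem_univ i.succ)
  · intro r hr r' hr' h
    rw [Finset.mem_coe, Finset.Nat.mem_antidiagonalTuple, Fin.sum_univ_succ] at hr hr'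
    have h' : ∀ i : Fin k, r i.succ = r' i.succ := fun i => congrFun h i
    simp only [h'] at hr
    funext i
    refine Fin.cases ?_ h' i
    omega

lemma le_card_antidiagonalTuple (k R : ℕ) :
    ((R : ℝ) / k) ^ k ≤ (Finset.Nat.antidiagonalTuple (k + 1) R).card := by
  have h := Finset.card_le_card_of_injOn (t := Finset.Nat.antidiagonalTuple (k + 1) R)
    (s := Fintype.piFinset fun _ : Fin k => Finset.range (R / k + 1))
    (fun v => Fin.cons (R - ∑ i, v i) v) ?_ ?_
  · simp only [Fintype.card_piFinset, Finset.card_range, Finset.prod_const, Finset.card_univ,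
      Fintype.card_fin] at h
    calc ((R : ℝ) / k) ^ k ≤ ((R / k + 1 : ℕ) : ℝ) ^ k := by
          gcongr
          rw [← Nat.floor_div_eq_div (K := ℝ)]
          push_cast
          exact (Nat.lt_floor_add_one _).le
      _ ≤ _ := by exact_mod_cast h
  · intro v hv
    simp only [Finset.mem_coe, Fintype.mem_piFinset, Finset.mem_range, Nat.lt_succ_iff] at hv
    rw [Finset.mem_coe, Finset.Nat.mem_antidiagonalTuple, Fin.sum_univ_succ]
    simp only [Fin.cons_zero, Fin.cons_succ]
    have : ∑ i, v i ≤ R := by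
      calc ∑ i, v i ≤ ∑ _i : Fin k, R / k := Finset.sum_le_sum fun i _ => hv i
        _ = k * (R / k) := by simp
        _ ≤ R := Nat.mul_div_le R k
    omega
  · intro v _ v' _ h
    exact (Fin.cons_inj.1 h).2

/-- Points of `[0, 1)ᵏ` all of whose coordinates lie in reduced annuli, of total depth `R`. -/
def reducedBoxes (k n R : ℕ) : Set (Fin k → ℝ) :=
  ⋃ r ∈ Finset.Nat.antidiagonalTuple k R, Set.univ.pi fun i => reducedAnnulus n (r i)

lemma mem_reducedBoxes {k n R : ℕ} {α : Fin k → ℝ} :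
    α ∈ reducedBoxes k n R ↔ ∃ r : Fin k → ℕ, ∑ i, r i = R ∧ ∀ i, α i ∈ reducedAnnulus n (r i) := by
  simp [reducedBoxes, Finset.Nat.mem_antidiagonalTuple]

lemma measurableSet_reducedBoxes (k n R : ℕ) : MeasurableSet (reducedBoxes k n R) :=
  Finset.measurableSet_biUnion _ fun _ _ =>
    MeasurableSet.univ_pi fun _ => measurableSet_reducedAnnulus _ _

lemma volume_reducedBoxes {k n : ℕ} (hn : 0 < n) (R : ℕ) :
    volume (reducedBoxes k n R) = ENNReal.ofReal ((Finset.Nat.antidiagonalTuple k R).card *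
      (((n.totient : ℝ) / n / 2) ^ k * (1 / 2) ^ R)) := by
  rw [reducedBoxes, measure_biUnion_finset ?_ fun _ _ =>
    MeasurableSet.univ_pi fun _ => measurableSet_reducedAnnulus _ _]
  · have : ∀ r ∈ Finset.Nat.antidiagonalTuple k R,
        volume (Set.univ.pi fun i => reducedAnnulus n (r i))
          = ENNReal.ofReal (((n.totient : ℝ) / n / 2) ^ k * (1 / 2) ^ R) := by
      intro r hr
      rw [volume_pi_pi]
      simp only [volume_reducedAnnulus hn]
      rw [← ENNReal.ofReal_prod_of_nonneg fun _ _ => by positivity]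
      congr 1
      rw [Finset.Nat.mem_antidiagonalTuple] at hr
      rw [← hr, ← Finset.prod_pow_eq_pow_sum]
      simp only [pow_succ]
      rw [← Fin.prod_const, ← Finset.prod_mul_distrib]
      exact Finset.prod_congr rfl fun i _ => by ring
    rw [Finset.sum_congr rfl this, Finset.sum_const, nsmul_eq_mul, ← ENNReal.ofReal_natCast,
      ← ENNReal.ofReal_mul (by positivity)]
  · intro r _ r' _ hne
    obtain ⟨i, hi⟩ := Function.ne_iff.1 hne
    exact Set.disjoint_univ_pi.2 ⟨i, disjoint_reducedAnnulus hn hi⟩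

lemma volume_reducedBoxes_inter_le {k n m : ℕ} (hn : 0 < n) (hm : 0 < m) (hnm : n ≠ m)
    (R S : ℕ) :
    volume (reducedBoxes k n R ∩ reducedBoxes k m S) ≤ ENNReal.ofReal
      ((Finset.Nat.antidiagonalTuple k R).card * (Finset.Nat.antidiagonalTuple k S).card *
        (2 ^ k * (1 / 2) ^ R * (1 / 2) ^ S)) := by
  have hsub : reducedBoxes k n R ∩ reducedBoxes k m S ⊆
      ⋃ q ∈ Finset.Nat.antidiagonalTuple k R ×ˢ Finset.Nat.antidiagonalTuple k S,
        Set.univ.pi fun i => reducedAnnulus n (q.1 i) ∩ reducedAnnulus m (q.2 i) := by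
    rintro α ⟨h1, h2⟩
    obtain ⟨r, hr, hr'⟩ := mem_reducedBoxes.1 h1
    obtain ⟨s, hs, hs'⟩ := mem_reducedBoxes.1 h2
    simp only [Set.mem_iUnion, exists_prop]
    exact ⟨(r, s), Finset.mem_product.2 ⟨Finset.Nat.mem_antidiagonalTuple.2 hr,
      Finset.Nat.mem_antidiagonalTuple.2 hs⟩, fun i _ => ⟨hr' i, hs' i⟩⟩
  refine (measure_mono hsub).trans ((measure_biUnion_finset_le _ _).trans ?_)
  have : ∀ q ∈ Finset.Nat.antidiagonalTuple k R ×ˢ Finset.Nat.antidiagonalTuple k S,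
      volume (Set.univ.pi fun i => reducedAnnulus n (q.1 i) ∩ reducedAnnulus m (q.2 i))
        ≤ ENNReal.ofReal (2 ^ k * (1 / 2) ^ R * (1 / 2) ^ S) := by
    intro q hq
    obtain ⟨h1, h2⟩ := Finset.mem_product.1 hq
    rw [Finset.Nat.mem_antidiagonalTuple] at h1 h2
    rw [volume_pi_pi]
    refine (Finset.prod_le_prod' fun i _ =>
      volume_reducedAnnulus_inter_le hn hm hnm (q.1 i) (q.2 i)).trans_eq ?_
    rw [← ENNReal.ofReal_prod_of_nonneg fun _ _ => by positivity]
    rw [← h1, ← h2, ← Finset.prod_pow_eq_pow_sum, ← Finset.prod_pow_eq_pow_sum, ← Fin.prod_const,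
      ← Finset.prod_mul_distrib, ← Finset.prod_mul_distrib]
  refine (Finset.sum_le_sum this).trans_eq ?_
  rw [Finset.sum_const, nsmul_eq_mul, ← ENNReal.ofReal_natCast,
    ← ENNReal.ofReal_mul (by positivity), Finset.card_product]
  push_cast
  rfl

/-- The second moment method: a lower bound for a union of quasi-independent sets. -/
lemma one_div_le_measureReal_biUnion {α ι : Type*} [MeasurableSpace α] (μ : Measure α)
    (S : Finset ι) (A : ι → Set α) (hA : ∀ i ∈ S, MeasurableSet (A i))
    (hfin : ∀ i ∈ S, μ (A i) ≠ ⊤) (C : ℝ) (hC : 0 ≤ C)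
    (hpair : ∀ i ∈ S, ∀ j ∈ S, i ≠ j → μ.real (A i ∩ A j) ≤ C * (μ.real (A i) * μ.real (A j)))
    (hs : 1 ≤ ∑ i ∈ S, μ.real (A i)) :
    1 / (C + 1) ≤ μ.real (⋃ i ∈ S, A i) := by
  classical
  set s := ∑ i ∈ S, μ.real (A i) with hsdef
  set l : ℝ := 1 / (C * s + 1) with hl
  have hCs : 0 < C * s + 1 := by nlinarith
  set F : α → ℝ := fun x => ∑ i ∈ S, (A i).indicator 1 x with hF
  have hFF : ∀ x, F x * F x = ∑ i ∈ S, ∑ j ∈ S, (A i ∩ A j).indicator (1 : α → ℝ) x := by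
    intro x
    simp only [hF, Finset.sum_mul_sum]
    refine Finset.sum_congr rfl fun i _ => Finset.sum_congr rfl fun j _ => ?_
    rw [Set.inter_indicator_one]; rfl
  have hU : MeasurableSet (⋃ i ∈ S, A i) := Finset.measurableSet_biUnion _ hA
  have hUfin : μ (⋃ i ∈ S, A i) ≠ ⊤ :=
    ((measure_biUnion_finset_le _ _).trans_lt
      (ENNReal.sum_lt_top.2 fun i hi => (hfin i hi).lt_top)).ne
  have hindInt : ∀ B : Set α, MeasurableSet B → μ B ≠ ⊤ →
      Integrable (B.indicator (1 : α → ℝ)) μ := fun B hB hf =>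
    (integrable_indicator_iff hB).2 (integrableOn_const hf)
  have hpt : ∀ x, 2 * l * F x - l ^ 2 * (F x * F x)
      ≤ (⋃ i ∈ S, A i).indicator (1 : α → ℝ) x := by
    intro x
    by_cases hx : x ∈ ⋃ i ∈ S, A i
    · rw [Set.indicator_of_mem hx, Pi.one_apply]
      nlinarith [sq_nonneg (1 - l * F x)]
    · have : F x = 0 := by
        refine Finset.sum_eq_zero fun i hi => Set.indicator_of_notMem (fun h => hx ?_) _
        exact Set.mem_biUnion hi h
      rw [this, Set.indicator_of_notMem hx]
      simp
  have hFi : Integrable F μ := integrable_finsetSum _ fun i hi => hindInt _ (hA i hi) (hfin i hi)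
  have hIint : ∀ i ∈ S, ∀ j ∈ S, Integrable ((A i ∩ A j).indicator (1 : α → ℝ)) μ :=
    fun i hi j hj => hindInt _ ((hA i hi).inter (hA j hj))
      (measure_ne_top_of_subset Set.inter_subset_left (hfin i hi))
  have hFFi : Integrable (fun x => F x * F x) μ := by
    simp only [hFF]
    exact integrable_finsetSum _ fun i hi => integrable_finsetSum _ fun j hj => hIint i hi j hj
  have h1 : ∫ x, F x ∂μ = s := by
    rw [hF, integral_finsetSum _ fun i hi => hindInt _ (hA i hi) (hfin i hi)]
    exact Finset.sum_congr rfl fun i hi => integral_indicator_one (hA i hi)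
  have h2 : ∫ x, F x * F x ∂μ ≤ C * s ^ 2 + s := by
    simp only [hFF]
    rw [integral_finsetSum _ fun i hi => integrable_finsetSum _ fun j hj => hIint i hi j hj]
    have : ∀ i ∈ S, ∫ x, ∑ j ∈ S, (A i ∩ A j).indicator (1 : α → ℝ) x ∂μ
        ≤ C * (μ.real (A i) * s) + μ.real (A i) := by
      intro i hi
      rw [integral_finsetSum _ fun j hj => hIint i hi j hj]
      calc ∑ j ∈ S, ∫ x, (A i ∩ A j).indicator (1 : α → ℝ) x ∂μ
          ≤ ∑ j ∈ S, (C * (μ.real (A i) * μ.real (A j)) + if i = j then μ.real (A i) else 0) := by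
            refine Finset.sum_le_sum fun j hj => ?_
            rw [integral_indicator_one ((hA i hi).inter (hA j hj))]
            split_ifs with h
            · subst h
              rw [Set.inter_self]
              have : 0 ≤ C * (μ.real (A i) * μ.real (A i)) := by positivity
              linarith
            · rw [add_zero]; exact hpair i hi j hj h
        _ = _ := by
            rw [Finset.sum_add_distrib, Finset.sum_ite_eq, if_pos hi, hsdef, Finset.mul_sum,
              Finset.mul_sum]
    refine (Finset.sum_le_sum this).trans_eq ?_
    rw [Finset.sum_add_distrib, ← Finset.mul_sum, ← Finset.sum_mul, ← hsdef]
    ring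
  have h3 : 2 * l * s - l ^ 2 * (C * s ^ 2 + s) ≤ μ.real (⋃ i ∈ S, A i) := by
    calc 2 * l * s - l ^ 2 * (C * s ^ 2 + s) ≤ 2 * l * s - l ^ 2 * ∫ x, F x * F x ∂μ := by
          gcongr
      _ = ∫ x, (2 * l * F x - l ^ 2 * (F x * F x)) ∂μ := by
          rw [integral_sub (hFi.const_mul _) (hFFi.const_mul _), integral_const_mul,
            integral_const_mul, h1]
      _ ≤ ∫ x, (⋃ i ∈ S, A i).indicator (1 : α → ℝ) x ∂μ :=
          integral_mono ((hFi.const_mul _).sub (hFFi.const_mul _)) (hindInt _ hU hUfin) hpt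
      _ = _ := integral_indicator_one hU
  refine le_trans ?_ h3
  have h4 : 2 * l * s - l ^ 2 * (C * s ^ 2 + s) = s / (C * s + 1) := by
    rw [hl]; field_simp; ring
  rw [h4, div_le_div_iff₀ (by positivity) hCs]
  nlinarith

lemma not_summable_condensed {k : ℕ} {φ : ℕ → ℝ} (h0 : ∀ n, 0 ≤ φ n)
    (hφ : Antitone φ) (h : ¬ Summable fun n : ℕ => φ n * Real.log n ^ k) :
    ¬ Summable fun j : ℕ => (4 : ℝ) ^ j * j ^ k * min (φ (4 ^ (j + 1))) ((1 / 4) ^ j) := by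
  intro hy
  apply h
  set y : ℕ → ℝ := fun j => (4 : ℝ) ^ j * j ^ k * min (φ (4 ^ (j + 1))) ((1 / 4) ^ j) with hydef
  have hy0 : ∀ j, 0 ≤ y j := fun j =>
    mul_nonneg (by positivity) (le_min (h0 _) (by positivity))
  obtain ⟨J₀, hJ₀⟩ := eventually_atTop.1
    ((hy.tendsto_atTop_zero.eventually (gt_mem_nhds one_pos)).and (eventually_ge_atTop 1))
  have hyeq : ∀ j, J₀ ≤ j → y j = (4 : ℝ) ^ j * j ^ k * φ (4 ^ (j + 1)) := by
    intro j hj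
    obtain ⟨h1, h2⟩ := hJ₀ j hj
    rcases min_choice (φ (4 ^ (j + 1))) ((1 / 4 : ℝ) ^ j) with h3 | h3
    · simp only [hydef, h3]
    · exfalso
      simp only [hydef, h3] at h1
      have h4 : (4 : ℝ) ^ j * (1 / 4) ^ j = 1 := by rw [← mul_pow]; norm_num
      have h5 : (1 : ℝ) ≤ (j : ℝ) ^ k := one_le_pow₀ (by exact_mod_cast h2)
      rw [mul_right_comm, h4, one_mul] at h1
      linarith
  set f : ℕ → ℝ := fun n => φ n * Real.log n ^ k with hf
  have hf0 : ∀ n, 0 ≤ f n := fun n =>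
    mul_nonneg (h0 n) (pow_nonneg (Real.log_natCast_nonneg n) _)
  have hblock : ∀ j, J₀ ≤ j →
      ∑ n ∈ Finset.Ico (4 ^ (j + 1) + 1) (4 ^ (j + 2) + 1), f n ≤ 12 * 6 ^ k * y j := by
    intro j hj
    have hj1 : (1 : ℝ) ≤ j := by exact_mod_cast (hJ₀ j hj).2
    have hterm : ∀ n ∈ Finset.Ico (4 ^ (j + 1) + 1) (4 ^ (j + 2) + 1),
        f n ≤ φ (4 ^ (j + 1)) * (6 ^ k * j ^ k) := by
      intro n hn
      obtain ⟨hn1, hn2⟩ := Finset.mem_Ico.1 hn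
      have hlog : Real.log n ≤ 6 * j := by
        have hn0 : (0 : ℝ) < n := by exact_mod_cast (Nat.zero_le _).trans_lt hn1
        have h4 : (n : ℝ) ≤ 4 ^ (j + 2) := by exact_mod_cast Nat.lt_succ_iff.1 hn2
        have h5 : Real.log n ≤ (j + 2) * Real.log 4 := by
          have := Real.log_le_log hn0 h4
          rw [Real.log_pow] at this
          exact_mod_cast this
        have h6 : Real.log 4 ≤ 2 := by
          rw [show (4 : ℝ) = 2 ^ 2 by norm_num, Real.log_pow]
          have := Real.log_two_lt_d9
          push_cast
          linarith
        have := mul_le_mul_of_nonneg_left h6 (show (0 : ℝ) ≤ j + 2 by linarith)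
        linarith
      rw [← mul_pow]
      exact mul_le_mul (hφ (by omega))
        (pow_le_pow_left₀ (Real.log_natCast_nonneg n) hlog k)
        (pow_nonneg (Real.log_natCast_nonneg n) _) (h0 _)
    refine (Finset.sum_le_sum hterm).trans ?_
    rw [Finset.sum_const, Nat.card_Ico, nsmul_eq_mul, hyeq j hj]
    have h7 : ((4 ^ (j + 2) + 1 - (4 ^ (j + 1) + 1) : ℕ) : ℝ) = 12 * 4 ^ j := by
      have : 4 ^ (j + 2) + 1 - (4 ^ (j + 1) + 1) = 12 * 4 ^ j := by
        rw [pow_succ, pow_succ]; omega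
      rw [this]; push_cast; ring
    rw [h7]
    exact le_of_eq (by ring)
  set B := ∑ n ∈ Finset.Ico 0 (4 ^ (J₀ + 1) + 1), f n with hB
  have hpart : ∀ J, ∑ n ∈ Finset.Ico 0 (4 ^ (J₀ + J + 1) + 1), f n
      ≤ B + 12 * 6 ^ k * ∑ i ∈ Finset.range J, y (J₀ + i) := by
    intro J
    induction J with
    | zero => simp [hB]
    | succ J ih =>
      rw [← Finset.sum_Ico_consecutive f (Nat.zero_le (4 ^ (J₀ + J + 1) + 1))
        (by gcongr <;> omega), Finset.sum_range_succ, mul_add]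
      have := hblock (J₀ + J) (by omega)
      rw [show J₀ + (J + 1) + 1 = J₀ + J + 2 by ring]
      linarith
  refine summable_of_sum_range_le (c := B + 12 * 6 ^ k * ∑' i, y (J₀ + i)) hf0 fun n => ?_
  have hys : Summable fun i => y (J₀ + i) := by
    simpa [add_comm] using (summable_nat_add_iff J₀).2 hy
  calc ∑ i ∈ Finset.range n, f i ≤ ∑ i ∈ Finset.Ico 0 (4 ^ (J₀ + n + 1) + 1), f i := by
        refine Finset.sum_le_sum_of_subset_of_nonneg ?_ fun i _ _ => hf0 i
        rw [← Finset.range_eq_Ico]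
        refine Finset.range_mono ?_
        have := Nat.lt_pow_self (n := J₀ + n + 1) (show 1 < 4 by norm_num)
        omega
    _ ≤ _ := hpart n
    _ ≤ _ := by
        gcongr
        exact hys.sum_le_tsum _ fun i _ => hy0 _

lemma measurable_dn : Measurable dn := by
  have : dn = fun x : ℝ => |x - (⌊x + 1 / 2⌋ : ℤ)| := by
    funext x; rw [dn, round_eq]
  rw [this]
  fun_prop

lemma le_measure_iInter_of_antitone {α : Type*} [MeasurableSpace α] {μ : Measure α}
    {s : ℕ → Set α} (hs : ∀ n, MeasurableSet (s n)) (hanti : Antitone s) (hfin : μ (s 0) ≠ ⊤)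
    {c : ENNReal} (hc : ∀ n, c ≤ μ (s n)) : c ≤ μ (⋂ n, s n) := by
  rw [hanti.measure_iInter (fun n => (hs n).nullMeasurableSet) ⟨0, hfin⟩]
  exact le_iInf hc

/-- Points admitting infinitely many `φ`-good multiplicative approximations. -/
def multApprox (k : ℕ) (φ : ℕ → ℝ) : Set (Fin k → ℝ) :=
  {α | {n : ℕ | 0 < n ∧ ∏ i, dn ((n : ℝ) * α i) < φ n}.Infinite}

lemma measurableSet_approx (k : ℕ) (n : ℕ) (c : ℝ) :
    MeasurableSet {α : Fin k → ℝ | ∏ i, dn ((n : ℝ) * α i) < c} := by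
  have : Measurable fun α : Fin k → ℝ => ∏ i, dn ((n : ℝ) * α i) :=
    Finset.measurable_prod _ fun i _ => measurable_dn.comp (by fun_prop)
  exact measurableSet_lt this measurable_const

lemma multApprox_eq (k : ℕ) (φ : ℕ → ℝ) : multApprox k φ =
    ⋂ M : ℕ, ⋃ n ∈ Set.Ioi M, {α : Fin k → ℝ | ∏ i, dn ((n : ℝ) * α i) < φ n} := by
  ext α
  simp only [multApprox, Set.mem_iInter, Set.mem_iUnion, Set.mem_Ioi, exists_prop,
    Set.mem_ofPred_eq, Set.infinite_iff_exists_gt]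
  constructor
  · intro h M
    obtain ⟨n, hn, hM⟩ := h M
    exact ⟨n, hM, hn.2⟩
  · intro h M
    obtain ⟨n, hM, hn⟩ := h M
    exact ⟨n, ⟨(Nat.zero_le _).trans_lt hM, hn⟩, hM⟩

lemma measurableSet_multApprox (k : ℕ) (φ : ℕ → ℝ) : MeasurableSet (multApprox k φ) := by
  rw [multApprox_eq]
  exact MeasurableSet.iInter fun M => MeasurableSet.biUnion (Set.to_countable _)
    fun n _ => measurableSet_approx k n _

lemma volume_unitCube (k : ℕ) : volume (Set.Icc (0 : Fin k → ℝ) 1) = 1 := by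
  simp [Real.volume_Icc_pi]

/-- In the divergence case, a uniform lower bound for the measure of the set of well approximable
points. -/
lemma le_volume_multApprox {k : ℕ} (hk : 1 ≤ k) {φ : ℕ → ℝ} (h0 : ∀ n, 0 ≤ φ n)
    (hφ : Antitone φ) (h : ¬ Summable fun n : ℕ => φ n * Real.log n ^ k) :
    ENNReal.ofReal (1 / (288 ^ (k + 1) + 1))
      ≤ volume (multApprox (k + 1) φ ∩ Set.Icc 0 1) := by
  have hpos : ∀ n, 0 < φ n := by
    intro n
    refine (h0 n).lt_of_ne fun hn => h ?_
    refine summable_of_ne_finset_zero (s := Finset.range n) fun m hm => ?_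
    have : φ m = 0 := le_antisymm (hn ▸ hφ (by simpa using hm)) (h0 m)
    simp [this]
  have hR : ∀ j : ℕ, ∃ R : ℕ, (1 / 2 : ℝ) ^ R < min (φ (4 ^ (j + 1))) ((1 / 4) ^ j) ∧
      min (φ (4 ^ (j + 1))) ((1 / 4) ^ j) / 2 ≤ (1 / 2 : ℝ) ^ R := by
    intro j
    obtain ⟨R, h1, h2⟩ := exists_nat_pow_near_of_lt_one
      (x := min (φ (4 ^ (j + 1))) ((1 / 4 : ℝ) ^ j)) (y := 1 / 2)
      (lt_min (hpos _) (by positivity))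
      ((min_le_right _ _).trans (pow_le_one₀ (by norm_num) (by norm_num))) (by norm_num)
      (by norm_num)
    exact ⟨R + 1, h1, by rw [pow_succ (1 / 2 : ℝ) R]; linarith⟩
  choose R hR1 hR2 using hR
  have hRj : ∀ j, j ≤ R j := by
    intro j
    have h1 : (1 / 2 : ℝ) ^ R j < (1 / 2) ^ j :=
      ((hR1 j).trans_le (min_le_right _ _)).trans_le
        (pow_le_pow_left₀ (by norm_num) (by norm_num) j)
    exact ((pow_lt_pow_iff_right_of_lt_one₀ (by norm_num) (by norm_num)).1 h1).le
  set good : ℕ → Finset ℕ := fun j => (Finset.Ioc (4 ^ j) (4 * 4 ^ j)).filter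
    fun n : ℕ => (n : ℝ) / 6 ≤ n.totient with hgood
  set A : (_ : ℕ) × ℕ → Set (Fin (k + 1) → ℝ) := fun q => reducedBoxes (k + 1) q.2 (R q.1) with hA
  have hgn : ∀ {j n}, n ∈ good j → 0 < n ∧ 4 ^ j < n ∧ n ≤ 4 ^ (j + 1) ∧
      (1 : ℝ) / 12 ≤ (n.totient : ℝ) / n / 2 := by
    intro j n hn
    simp only [hgood, Finset.mem_filter, Finset.mem_Ioc] at hn
    have hn0 : 0 < n := by omega
    refine ⟨hn0, hn.1.1, by rw [pow_succ]; omega, ?_⟩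
    have hn0' : (0 : ℝ) < n := by exact_mod_cast hn0
    rw [div_div, div_le_div_iff₀ (by norm_num) (by positivity)]
    linarith [hn.2]
  have hreal : ∀ {j n}, n ∈ good j → volume.real (A ⟨j, n⟩) =
      (Finset.Nat.antidiagonalTuple (k + 1) (R j)).card *
      (((n.totient : ℝ) / n / 2) ^ (k + 1) * (1 / 2) ^ R j) := by
    intro j n hn
    rw [Measure.real, hA, volume_reducedBoxes (hgn hn).1, ENNReal.toReal_ofReal (by positivity)]
  have hreal_ge : ∀ {j n}, n ∈ good j →
      (Finset.Nat.antidiagonalTuple (k + 1) (R j)).card * ((1 / 12) ^ (k + 1) * (1 / 2) ^ R j)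
        ≤ volume.real (A ⟨j, n⟩) := by
    intro j n hn
    rw [hreal hn]
    exact mul_le_mul_of_nonneg_left (mul_le_mul_of_nonneg_right
      (pow_le_pow_left₀ (by norm_num) (hgn hn).2.2.2 _) (by positivity)) (by positivity)
  have hmain : ∀ M : ℕ, ENNReal.ofReal (1 / (288 ^ (k + 1) + 1)) ≤
      volume ((⋃ n ∈ Set.Ioi M, {α : Fin (k + 1) → ℝ | ∏ i, dn ((n : ℝ) * α i) < φ n})
        ∩ Set.Icc 0 1) := by
    intro M
    set y : ℕ → ℝ := fun j => (4 : ℝ) ^ j * j ^ k * min (φ (4 ^ (j + 1))) ((1 / 4) ^ j) with hydef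
    have hy0 : ∀ j, 0 ≤ y j := fun j =>
      mul_nonneg (by positivity) (le_min (h0 _) (by positivity))
    set c : ℝ := 1 / 4 * (1 / 12) ^ (k + 1) * (1 / k) ^ k with hc
    have hk' : (0 : ℝ) < k := by exact_mod_cast hk
    have hc0 : 0 < c := by positivity
    have hdiv := (not_summable_iff_tendsto_nat_atTop_of_nonneg hy0).1
      (not_summable_condensed h0 hφ h)
    obtain ⟨J, hJ⟩ := (hdiv.eventually_ge_atTop
      (1 / c + ∑ j ∈ Finset.range M, y j)).and (eventually_ge_atTop M) |>.exists
    set S : Finset ((_ : ℕ) × ℕ) := (Finset.Ico M J).sigma good with hS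
    have hsum : 1 ≤ ∑ q ∈ S, volume.real (A q) := by
      have h1 : ∀ j, c * y j ≤ ∑ n ∈ good j, volume.real (A ⟨j, n⟩) := by
        intro j
        have hcard := half_le_card_large_totient (4 ^ j)
        have hT := le_card_antidiagonalTuple k (R j)
        have hRj' : (j : ℝ) ≤ R j := by exact_mod_cast hRj j
        have hmin0 : 0 ≤ min (φ (4 ^ (j + 1))) ((1 / 4 : ℝ) ^ j) := le_min (h0 _) (by positivity)
        push_cast at hcard
        calc c * y j = (4 ^ j / 2) * (((j : ℝ) / k) ^ k * ((1 / 12) ^ (k + 1) *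
              (min (φ (4 ^ (j + 1))) ((1 / 4) ^ j) / 2))) := by
              rw [hc, hydef, div_pow, div_pow, one_pow]; ring
          _ ≤ (good j).card * ((Finset.Nat.antidiagonalTuple (k + 1) (R j)).card *
              ((1 / 12) ^ (k + 1) * (1 / 2) ^ R j)) := by
              refine mul_le_mul hcard ?_ (by positivity) (by positivity)
              refine mul_le_mul ?_ ?_ (by positivity) (by positivity)
              · exact le_trans (by gcongr) hT
              · exact mul_le_mul_of_nonneg_left (hR2 j) (by positivity)
          _ ≤ _ := by
              rw [← nsmul_eq_mul]
              exact Finset.card_nsmul_le_sum _ _ _ fun n hn => hreal_ge hn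
      rw [hS, Finset.sum_sigma]
      refine le_trans ?_ (Finset.sum_le_sum fun j _ => h1 j)
      rw [← Finset.mul_sum, Finset.sum_Ico_eq_sub _ hJ.2]
      have := mul_le_mul_of_nonneg_left (sub_le_sub_right hJ.1 (∑ j ∈ Finset.range M, y j)) hc0.le
      rw [add_sub_cancel_right, mul_one_div_cancel hc0.ne'] at this
      exact this
    have hpair : ∀ p ∈ S, ∀ q ∈ S, p ≠ q →
        volume.real (A p ∩ A q) ≤ 288 ^ (k + 1) * (volume.real (A p) * volume.real (A q)) := by
      rintro ⟨i, n⟩ hp ⟨j, m⟩ hq hne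
      have hn := (Finset.mem_sigma.1 hp).2
      have hm := (Finset.mem_sigma.1 hq).2
      simp only at hn hm
      have hnm : n ≠ m := by
        rintro rfl
        apply hne
        have h1 := (hgn hn).2.1.trans_le (hgn hm).2.2.1
        have h2 := (hgn hm).2.1.trans_le (hgn hn).2.2.1
        rw [Nat.pow_lt_pow_iff_right (by norm_num)] at h1 h2
        rw [show i = j by omega]
      calc volume.real (A ⟨i, n⟩ ∩ A ⟨j, m⟩)
          ≤ (Finset.Nat.antidiagonalTuple (k + 1) (R i)).card *
            (Finset.Nat.antidiagonalTuple (k + 1) (R j)).card *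
            (2 ^ (k + 1) * (1 / 2) ^ R i * (1 / 2) ^ R j) :=
            ENNReal.toReal_le_of_le_ofReal (by positivity)
              (volume_reducedBoxes_inter_le (hgn hn).1 (hgn hm).1 hnm _ _)
        _ = 288 ^ (k + 1) * (((Finset.Nat.antidiagonalTuple (k + 1) (R i)).card *
              ((1 / 12) ^ (k + 1) * (1 / 2) ^ R i)) *
              ((Finset.Nat.antidiagonalTuple (k + 1) (R j)).card *
              ((1 / 12) ^ (k + 1) * (1 / 2) ^ R j))) := by
            rw [show (288 : ℝ) = 2 * (12 * 12) by norm_num, mul_pow, mul_pow, one_div_pow 12]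
            field_simp
        _ ≤ _ := by
            gcongr
            · exact hreal_ge hn
            · exact hreal_ge hm
    have hAfin : ∀ q ∈ S, volume (A q) ≠ ⊤ := by
      rintro ⟨j, n⟩ hq
      have hn := (Finset.mem_sigma.1 hq).2
      rw [hA, volume_reducedBoxes (hgn hn).1]
      exact ENNReal.ofReal_ne_top
    have hlow := one_div_le_measureReal_biUnion volume S A
      (fun q _ => measurableSet_reducedBoxes _ _ _) hAfin (288 ^ (k + 1)) (by positivity) hpair hsum
    refine (ENNReal.ofReal_le_ofReal hlow).trans ?_
    rw [Measure.real]
    refine ENNReal.ofReal_toReal_le.trans (measure_mono ?_)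
    refine Set.iUnion₂_subset ?_
    rintro ⟨j, n⟩ hq α hα
    have hq' := Finset.mem_sigma.1 hq
    have hn := hgn hq'.2
    simp only at hn
    have hMj : M ≤ j := (Finset.mem_Ico.1 hq'.1).1
    obtain ⟨r, hr, hr'⟩ := mem_reducedBoxes.1 hα
    refine ⟨?_, ?_⟩
    · simp only [Set.mem_iUnion, Set.mem_Ioi, exists_prop, Set.mem_ofPred_eq]
      refine ⟨n, ?_, ?_⟩
      · have := Nat.lt_pow_self (n := j) (show 1 < 4 by norm_num)
        omega
      · calc ∏ i, dn ((n : ℝ) * α i) ≤ ∏ i, (1 / 2 : ℝ) ^ r i :=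
              Finset.prod_le_prod (fun i _ => dn_nonneg _)
                fun i _ => (dn_lt_of_mem_reducedAnnulus hn.1 (hr' i)).le
          _ = (1 / 2) ^ R j := by rw [Finset.prod_pow_eq_pow_sum, hr]
          _ < φ (4 ^ (j + 1)) := (hR1 j).trans_le (min_le_left _ _)
          _ ≤ φ n := hφ hn.2.2.1
    · have := fun i => reducedAnnulus_subset hn.1 (hr' i)
      exact ⟨fun i => (this i).1, fun i => (this i).2⟩
  rw [multApprox_eq, Set.iInter_inter]
  refine le_measure_iInter_of_antitone (fun M => ?_) ?_ ?_ hmain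
  · exact (MeasurableSet.biUnion (Set.to_countable _)
      fun n _ => measurableSet_approx _ n _).inter measurableSet_Icc
  · intro M M' hM
    exact Set.inter_subset_inter_left _ (Set.biUnion_subset_biUnion_left (Set.Ioi_subset_Ioi hM))
  · refine measure_ne_top_of_subset Set.inter_subset_right ?_
    rw [volume_unitCube]
    exact ENNReal.one_ne_top

/-- A zero-one law: a `ℤᵏ`-periodic set stable under doubling is null or full. -/
lemma volume_inter_unitCube_eq_one {k : ℕ} {E : Set (Fin k → ℝ)}
    (hper : ∀ α ∈ E, ∀ z : Fin k → ℤ, (fun i => α i + z i) ∈ E)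
    (h2 : ∀ α ∈ E, (2 : ℝ) • α ∈ E) (hpos : volume (E ∩ Set.Icc 0 1) ≠ 0) :
    volume (E ∩ Set.Icc 0 1) = 1 := by
  have h2j : ∀ (j : ℕ), ∀ α ∈ E, ((2 : ℝ) ^ j) • α ∈ E := by
    intro j
    induction j with
    | zero => intro α hα; simpa using hα
    | succ j ih =>
      intro α hα
      rw [pow_succ', mul_smul]
      exact h2 _ (ih α hα)
  apply le_antisymm ((measure_mono Set.inter_subset_right).trans_eq (volume_unitCube k))
  have hne : volume.restrict E ≠ 0 := by
    rw [Ne, Measure.restrict_eq_zero]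
    exact fun h => hpos (measure_mono_null Set.inter_subset_left h)
  have : (ae (volume.restrict E)).NeBot := ae_neBot.2 hne
  obtain ⟨x, hx⟩ := (IsUnifLocDoublingMeasure.ae_tendsto_measure_inter_div
    (volume : Measure (Fin k → ℝ)) E 1).exists
  set z : ℕ → Fin k → ℤ := fun j i => ⌊2 ^ j * x i⌋ with hz
  set w : ℕ → Fin k → ℝ := fun j i => (z j i + 1 / 2) / 2 ^ j with hw
  set δ : ℕ → ℝ := fun j => 1 / 2 / 2 ^ j with hδ
  have hδ0 : ∀ j, 0 < δ j := fun j => by positivity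
  have hδlim : Tendsto δ atTop (nhdsWithin 0 (Set.Ioi 0)) := by
    refine tendsto_nhdsWithin_iff.2 ⟨?_, Eventually.of_forall hδ0⟩
    have := (tendsto_pow_atTop_nhds_zero_of_lt_one (r := (1 / 2 : ℝ)) (by norm_num)
      (by norm_num)).const_mul (1 / 2)
    rw [mul_zero] at this
    refine this.congr fun j => ?_
    simp only [hδ, one_div_pow]
    ring
  have hmem : ∀ j, x ∈ Metric.closedBall (w j) (1 * δ j) := by
    intro j
    rw [one_mul, Metric.mem_closedBall, dist_pi_le_iff (hδ0 j).le]
    intro i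
    have h2p : (0 : ℝ) < 2 ^ j := by positivity
    have e : x i - w j i = (2 ^ j * x i - z j i - 1 / 2) / 2 ^ j := by
      simp only [hw]; field_simp; ring
    rw [Real.dist_eq, e, abs_div, abs_of_pos h2p, hδ]
    have hf1 := Int.floor_le (2 ^ j * x i)
    have hf2 := Int.lt_floor_add_one (2 ^ j * x i)
    refine div_le_div_of_nonneg_right ?_ h2p.le
    rw [abs_le]
    constructor <;> simp only [hz] <;> linarith
  refine le_of_tendsto (hx w δ hδlim (Eventually.of_forall hmem)) (Eventually.of_forall fun j => ?_)
  have h2p : (0 : ℝ) < 2 ^ j := by positivity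
  refine ENNReal.div_le_of_le_mul ?_
  have hsub : E ∩ Metric.closedBall (w j) (δ j) ⊆
      (((2 : ℝ) ^ j) • ·) ⁻¹' ((· + fun i => ((-z j i : ℤ) : ℝ)) ⁻¹' (E ∩ Set.Icc 0 1)) := by
    rintro y ⟨hyE, hyB⟩
    refine ⟨hper _ (h2j j y hyE) fun i => -z j i, ?_⟩
    rw [Metric.mem_closedBall, dist_pi_le_iff (hδ0 j).le] at hyB
    have hcoord : ∀ i, 0 ≤ 2 ^ j * y i - z j i ∧ 2 ^ j * y i - z j i ≤ 1 := by
      intro i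
      have h := hyB i
      have e : y i - w j i = (2 ^ j * y i - z j i - 1 / 2) / 2 ^ j := by
        simp only [hw]; field_simp; ring
      rw [Real.dist_eq, e, abs_div, abs_of_pos h2p, hδ, div_le_div_iff_of_pos_right h2p,
        abs_le] at h
      constructor <;> linarith
    constructor
    · intro i
      simp only [Pi.zero_apply, Pi.add_apply, Pi.smul_apply, smul_eq_mul, Int.cast_neg]
      linarith [(hcoord i).1]
    · intro i
      simp only [Pi.one_apply, Pi.add_apply, Pi.smul_apply, smul_eq_mul, Int.cast_neg]
      linarith [(hcoord i).2]
  refine (measure_mono hsub).trans_eq ?_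
  rw [Measure.addHaar_preimage_smul _ h2p.ne', measure_preimage_add_right,
    Real.volume_pi_closedBall _ (hδ0 j).le, mul_comm]
  congr 2
  simp only [Module.finrank_fintype_fun_eq_card, Fintype.card_fin, hδ]
  rw [abs_of_pos (by positivity), ← inv_pow]
  congr 1
  ring

lemma dn_add_int (x : ℝ) (z : ℤ) : dn (x + z) = dn x := by
  simp [dn, round_add_intCast]

lemma dn_two_mul_le (x : ℝ) : dn (2 * x) ≤ 2 * dn x := by
  refine (dn_le _ (2 * round x)).trans_eq ?_
  push_cast
  rw [← mul_sub, abs_mul, abs_two, dn]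

lemma add_int_mem_multApprox {k : ℕ} {φ : ℕ → ℝ} {α : Fin k → ℝ} (hα : α ∈ multApprox k φ)
    (z : Fin k → ℤ) : (fun i => α i + z i) ∈ multApprox k φ := by
  have : ∀ (n : ℕ) (i : Fin k), dn ((n : ℝ) * (α i + z i)) = dn (n * α i) := by
    intro n i
    rw [← dn_add_int (n * α i) (n * z i)]
    congr 1
    push_cast
    ring
  simp only [multApprox, Set.mem_ofPred_eq, this]
  exact hα

lemma two_smul_mem_multApprox {k : ℕ} {φ φ' : ℕ → ℝ} (hφ : ∀ n, 2 ^ k * φ n ≤ φ' n)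
    {α : Fin k → ℝ} (hα : α ∈ multApprox k φ) : (2 : ℝ) • α ∈ multApprox k φ' := by
  refine hα.mono ?_
  rintro n ⟨hn, h⟩
  refine ⟨hn, ?_⟩
  calc ∏ i, dn ((n : ℝ) * ((2 : ℝ) • α) i) ≤ ∏ i : Fin k, 2 * dn (n * α i) := by
        refine Finset.prod_le_prod (fun i _ => dn_nonneg _) fun i _ => ?_
        rw [Pi.smul_apply, smul_eq_mul, mul_left_comm]
        exact dn_two_mul_le _
    _ = 2 ^ k * ∏ i, dn (n * α i) := by
        rw [Finset.prod_mul_distrib, Fin.prod_const]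
    _ < 2 ^ k * φ n := by gcongr
    _ ≤ φ' n := hφ n

lemma volume_multApprox_of_not_summable {k : ℕ} (hk : 1 ≤ k) {φ : ℕ → ℝ} (h0 : ∀ n, 0 ≤ φ n)
    (hφ : Antitone φ) (h : ¬ Summable fun n : ℕ => φ n * Real.log n ^ k) :
    volume (multApprox (k + 1) φ ∩ Set.Icc 0 1) = 1 := by
  set Φ : ℕ → ℕ → ℝ := fun j n => (1 / 2) ^ j * φ n with hΦ
  set E : Set (Fin (k + 1) → ℝ) := ⋂ j, multApprox (k + 1) (Φ j) with hE
  have hanti : Antitone fun j => multApprox (k + 1) (Φ j) := by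
    intro i j hij α hα
    refine hα.mono ?_
    rintro n ⟨hn, hlt⟩
    refine ⟨hn, hlt.trans_le ?_⟩
    exact mul_le_mul_of_nonneg_right
      (pow_le_pow_of_le_one (by norm_num) (by norm_num) hij) (h0 n)
  have hlow : ENNReal.ofReal (1 / (288 ^ (k + 1) + 1)) ≤ volume (E ∩ Set.Icc 0 1) := by
    rw [hE, Set.iInter_inter]
    refine le_measure_iInter_of_antitone
      (fun j => (measurableSet_multApprox _ _).inter measurableSet_Icc)
      (fun i j hij => Set.inter_subset_inter_left _ (hanti hij)) ?_ fun j => ?_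
    · refine measure_ne_top_of_subset Set.inter_subset_right ?_
      rw [volume_unitCube]
      exact ENNReal.one_ne_top
    · refine le_volume_multApprox hk (fun n => mul_nonneg (by positivity) (h0 n))
        (fun a b hab => mul_le_mul_of_nonneg_left (hφ hab) (by positivity)) ?_
      simp only [hΦ, mul_assoc]
      rwa [summable_mul_left_iff (by positivity)]
  have hone : volume (E ∩ Set.Icc 0 1) = 1 := by
    refine volume_inter_unitCube_eq_one ?_ ?_ ?_
    · intro α hα z
      exact Set.mem_iInter.2 fun j => add_int_mem_multApprox (Set.mem_iInter.1 hα j) z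
    · intro α hα
      refine Set.mem_iInter.2 fun j =>
        two_smul_mem_multApprox (fun n => ?_) (Set.mem_iInter.1 hα (j + (k + 1)))
      have e : (2 : ℝ) ^ (k + 1) * (1 / 2) ^ (k + 1) = 1 := by rw [← mul_pow]; norm_num
      calc (2 : ℝ) ^ (k + 1) * ((1 / 2) ^ (j + (k + 1)) * φ n)
          = (2 ^ (k + 1) * (1 / 2) ^ (k + 1)) * ((1 / 2) ^ j * φ n) := by
            rw [pow_add (1 / 2 : ℝ) j]; ring
        _ ≤ (1 / 2) ^ j * φ n := by rw [e, one_mul]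
    · refine (lt_of_lt_of_le ?_ hlow).ne'
      exact ENNReal.ofReal_pos.2 (by positivity)
  refine le_antisymm ((measure_mono Set.inter_subset_right).trans_eq (volume_unitCube _)) ?_
  rw [← hone]
  refine measure_mono (Set.inter_subset_inter_left _ ?_)
  refine (Set.iInter_subset _ 0).trans_eq ?_
  simp [hΦ]

lemma volume_dn_le_le {n : ℕ} (hn : 0 < n) {δ : ℝ} (hδ : 0 ≤ δ) :
    volume {x : ℝ | x ∈ Set.Icc (0 : ℝ) 1 ∧ dn (n * x) ≤ δ} ≤ ENNReal.ofReal (4 * δ) := by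
  have hn' : (0 : ℝ) < n := by exact_mod_cast hn
  have hsub : {x : ℝ | x ∈ Set.Icc (0 : ℝ) 1 ∧ dn (n * x) ≤ δ} ⊆
      ⋃ a ∈ Finset.range (n + 1), Set.Icc (((a : ℝ) - δ) / n) ((a + δ) / n) := by
    rintro x ⟨⟨hx0, hx1⟩, hx⟩
    have hr := abs_le.1 (abs_sub_round (n * x))
    have hx' := abs_le.1 hx
    have h1 : (0 : ℝ) ≤ n * x := by positivity
    have h2 : (n : ℝ) * x ≤ n := by nlinarith
    have h3 : (-1 : ℝ) < round (n * x) := by linarith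
    have h4 : (round (n * x) : ℝ) < n + 1 := by linarith
    have h3' : -1 < round (n * x) := by exact_mod_cast h3
    have h4' : round (n * x) < n + 1 := by exact_mod_cast h4
    obtain ⟨a, ha⟩ := Int.eq_ofNat_of_zero_le (show 0 ≤ round (n * x) by omega)
    rw [ha] at hx' h4'
    simp only [Set.mem_iUnion, exists_prop, Finset.mem_range, Set.mem_Icc]
    refine ⟨a, by omega, ?_⟩
    rw [div_le_iff₀ hn', le_div_iff₀ hn']
    push_cast at hx'
    constructor <;> linarith
  refine (measure_mono hsub).trans ((measure_biUnion_finset_le _ _).trans ?_)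
  simp only [Real.volume_Icc]
  have : ∀ a : ℕ, ((a : ℝ) + δ) / n - (a - δ) / n = 2 * δ / n := fun a => by ring
  simp only [this, Finset.sum_const, Finset.card_range, nsmul_eq_mul]
  rw [← ENNReal.ofReal_natCast, ← ENNReal.ofReal_mul (by positivity)]
  refine ENNReal.ofReal_le_ofReal ?_
  have : (1 : ℝ) ≤ n := by exact_mod_cast hn
  rw [mul_div_assoc', div_le_iff₀ hn']
  push_cast
  nlinarith

lemma exists_le_sum_eq {k : ℕ} (ρ : Fin k → ℕ) {R : ℕ} (h : R ≤ ∑ i, ρ i) :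
    ∃ r : Fin k → ℕ, (∀ i, r i ≤ ρ i) ∧ ∑ i, r i = R := by
  induction k generalizing R with
  | zero => exact ⟨ρ, fun _ => le_rfl, by simp at h ⊢; omega⟩
  | succ k ih =>
    rw [Fin.sum_univ_succ] at h
    obtain ⟨r, hr, hs⟩ := ih (fun i => ρ i.succ) (R := R - min (ρ 0) R) (by omega)
    refine ⟨Fin.cons (min (ρ 0) R) r, Fin.cases (by simp) (by simpa using hr), ?_⟩
    rw [Fin.sum_univ_succ]
    simp only [Fin.cons_zero, Fin.cons_succ]
    omega

lemma exists_dyadic_of_prod_lt {k R : ℕ} (d : Fin k → ℝ) (h0 : ∀ i, 0 ≤ d i) (h1 : ∀ i, d i ≤ 1)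
    (h : ∏ i, d i < (1 / 2) ^ (R + k)) :
    ∃ r : Fin k → ℕ, ∑ i, r i = R ∧ ∀ i, d i ≤ (1 / 2) ^ r i := by
  have hρ : ∀ i, ∃ ρ : ℕ, d i ≤ (1 / 2) ^ ρ ∧ (d i = 0 → ρ = R) ∧
      (d i ≠ 0 → (1 / 2) ^ (ρ + 1) < d i) := by
    intro i
    by_cases hd : d i = 0
    · exact ⟨R, by rw [hd]; positivity, fun _ => rfl, fun h => absurd hd h⟩
    · obtain ⟨ρ, h2, h3⟩ := exists_nat_pow_near_of_lt_one ((h0 i).lt_of_ne' hd) (h1 i)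
        (show (0 : ℝ) < 1 / 2 by norm_num) (by norm_num)
      exact ⟨ρ, h3, fun h => absurd h hd, fun _ => h2⟩
  choose ρ hρ1 hρ2 hρ3 using hρ
  have hsum : R ≤ ∑ i, ρ i := by
    by_cases hz : ∃ i, d i = 0
    · obtain ⟨i, hi⟩ := hz
      rw [← hρ2 i hi]
      exact Finset.single_le_sum (f := ρ) (fun _ _ => Nat.zero_le _) (Finset.mem_univ i)
    · push Not at hz
      have h4 : (1 / 2 : ℝ) ^ (∑ i, ρ i + k) ≤ ∏ i, d i := by
        calc (1 / 2 : ℝ) ^ (∑ i, ρ i + k) = ∏ i, (1 / 2 : ℝ) ^ (ρ i + 1) := by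
              rw [Finset.prod_pow_eq_pow_sum, Finset.sum_add_distrib]; simp
          _ ≤ _ := Finset.prod_le_prod (fun _ _ => by positivity) fun i _ => (hρ3 i (hz i)).le
      have h5 := (pow_lt_pow_iff_right_of_lt_one₀ (by norm_num) (by norm_num)).1 (h4.trans_lt h)
      omega
  obtain ⟨r, hr, hs⟩ := exists_le_sum_eq ρ hsum
  exact ⟨r, hs, fun i => (hρ1 i).trans
    (pow_le_pow_of_le_one (by norm_num) (by norm_num) (hr i))⟩

lemma volume_prod_dn_lt_le (k : ℕ) {n : ℕ} (hn : 0 < n) (R : ℕ) :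
    volume ({α : Fin (k + 1) → ℝ | ∏ i, dn ((n : ℝ) * α i) < (1 / 2) ^ (R + (k + 1))}
        ∩ Set.Icc 0 1)
      ≤ ENNReal.ofReal ((R + 1) ^ k * (4 ^ (k + 1) * (1 / 2) ^ R)) := by
  have hsub : {α : Fin (k + 1) → ℝ | ∏ i, dn ((n : ℝ) * α i) < (1 / 2) ^ (R + (k + 1))}
        ∩ Set.Icc 0 1 ⊆ ⋃ r ∈ Finset.Nat.antidiagonalTuple (k + 1) R, Set.univ.pi fun i =>
          {x : ℝ | x ∈ Set.Icc (0 : ℝ) 1 ∧ dn (n * x) ≤ (1 / 2) ^ r i} := by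
    rintro α ⟨hα, hα1⟩
    obtain ⟨r, hr, hd⟩ := exists_dyadic_of_prod_lt (fun i => dn (n * α i))
      (fun _ => dn_nonneg _) (fun i => (abs_sub_round _).trans (by norm_num)) hα
    simp only [Set.mem_iUnion, exists_prop, Finset.Nat.mem_antidiagonalTuple]
    exact ⟨r, hr, fun i _ => ⟨⟨hα1.1 i, hα1.2 i⟩, hd i⟩⟩
  refine (measure_mono hsub).trans ((measure_biUnion_finset_le _ _).trans ?_)
  have : ∀ r ∈ Finset.Nat.antidiagonalTuple (k + 1) R, volume (Set.univ.pi fun i =>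
      {x : ℝ | x ∈ Set.Icc (0 : ℝ) 1 ∧ dn (n * x) ≤ (1 / 2) ^ r i})
      ≤ ENNReal.ofReal (4 ^ (k + 1) * (1 / 2) ^ R) := by
    intro r hr
    rw [Finset.Nat.mem_antidiagonalTuple] at hr
    rw [volume_pi_pi]
    refine (Finset.prod_le_prod' fun i _ => volume_dn_le_le hn (by positivity)).trans_eq ?_
    rw [← ENNReal.ofReal_prod_of_nonneg fun _ _ => by positivity, Finset.prod_mul_distrib,
      Fin.prod_const, Finset.prod_pow_eq_pow_sum, hr]
  refine (Finset.sum_le_sum this).trans ?_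
  rw [Finset.sum_const, nsmul_eq_mul, ← ENNReal.ofReal_natCast,
    ← ENNReal.ofReal_mul (by positivity)]
  refine ENNReal.ofReal_le_ofReal (mul_le_mul_of_nonneg_right ?_ (by positivity))
  exact_mod_cast card_antidiagonalTuple_le k R

lemma summable_log_pow_div_sq (k : ℕ) :
    Summable fun n : ℕ => 1 / (n : ℝ) ^ 2 * Real.log n ^ k := by
  have h1 : (fun x : ℝ => Real.log x ^ k) =o[atTop] fun x => x ^ (1 / 2 : ℝ) := by
    simpa using isLittleO_log_rpow_rpow_atTop (k : ℝ) (show (0 : ℝ) < 1 / 2 by norm_num)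
  have h2 := h1.comp_tendsto tendsto_natCast_atTop_atTop
  refine summable_of_isBigO_nat
    (Real.summable_nat_rpow.2 (show (-(3 / 2) : ℝ) < -1 by norm_num)) ?_
  have h3 := (Asymptotics.isBigO_refl (fun n : ℕ => 1 / (n : ℝ) ^ 2) atTop).mul h2.isBigO
  refine h3.trans_eventuallyEq ?_
  filter_upwards [eventually_gt_atTop 0] with n hn
  have hn' : (0 : ℝ) < n := by exact_mod_cast hn
  simp only [Function.comp]
  rw [one_div, ← Real.rpow_natCast, ← Real.rpow_neg hn'.le, ← Real.rpow_add hn']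
  norm_num

lemma volume_multApprox_of_summable {k : ℕ} {φ : ℕ → ℝ} (h0 : ∀ n, 0 ≤ φ n)
    (h : Summable fun n : ℕ => φ n * Real.log n ^ k) :
    volume (multApprox (k + 1) φ ∩ Set.Icc 0 1) = 0 := by
  have hlog3 : ∀ n : ℕ, 3 ≤ n → 1 ≤ Real.log n := by
    intro n hn
    rw [Real.le_log_iff_exp_le (by positivity)]
    have : (3 : ℝ) ≤ n := by exact_mod_cast hn
    linarith [Real.exp_one_lt_d9]
  have hev : ∀ᶠ n : ℕ in atTop, 3 ≤ n ∧ φ n + 1 / (n : ℝ) ^ 2 ≤ (1 / 2) ^ (k + 1) := by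
    have h1 := (h.tendsto_atTop_zero.add (summable_log_pow_div_sq k).tendsto_atTop_zero)
    rw [add_zero] at h1
    filter_upwards [eventually_ge_atTop 3, h1.eventually
      (gt_mem_nhds (show (0 : ℝ) < (1 / 2) ^ (k + 1) by positivity))] with n hn hlt
    refine ⟨hn, le_trans ?_ hlt.le⟩
    rw [← add_mul]
    exact le_mul_of_one_le_right (add_nonneg (h0 n) (by positivity)) (one_le_pow₀ (hlog3 n hn))
  obtain ⟨N, hN⟩ := eventually_atTop.1 hev
  set g : ℕ → ℝ := fun n => 4 ^ k * 4 ^ (k + 1) * 2 * 2 ^ (k + 1) *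
    (φ n * Real.log n ^ k + 1 / (n : ℝ) ^ 2 * Real.log n ^ k) with hg
  have hgs : Summable g := (h.add (summable_log_pow_div_sq k)).mul_left _
  have hbound : ∀ n : ℕ, volume {α : Fin (k + 1) → ℝ |
      N ≤ n ∧ ∏ i, dn ((n : ℝ) * α i) < φ n ∧ α ∈ Set.Icc (0 : Fin (k + 1) → ℝ) 1}
      ≤ ENNReal.ofReal (g n) := by
    intro n
    by_cases hn : N ≤ n
    swap
    · simp [hn]
    obtain ⟨hn3, hη⟩ := hN n hn
    have hn' : (0 : ℝ) < n := by positivity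
    set η := φ n + 1 / (n : ℝ) ^ 2 with hηdef
    have hη0 : 1 / (n : ℝ) ^ 2 ≤ η := le_add_of_nonneg_left (h0 n)
    have hηpos : 0 < η := lt_of_lt_of_le (by positivity) hη0
    have h2k : (2 : ℝ) ^ (k + 1) * (1 / 2) ^ (k + 1) = 1 := by rw [← mul_pow]; norm_num
    obtain ⟨R, hR1, hR2⟩ := exists_nat_pow_near_of_lt_one (x := 2 ^ (k + 1) * η) (y := 1 / 2)
      (by positivity)
      ((mul_le_mul_of_nonneg_left hη (by positivity)).trans_eq h2k) (by norm_num) (by norm_num)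
    have hR3 : η ≤ (1 / 2) ^ (R + (k + 1)) := by
      have := mul_le_mul_of_nonneg_right hR2 (show (0 : ℝ) ≤ (1 / 2) ^ (k + 1) by positivity)
      rw [pow_add]
      calc η = 2 ^ (k + 1) * η * (1 / 2) ^ (k + 1) := by rw [mul_right_comm, h2k, one_mul]
        _ ≤ _ := this
    have hRlog : (R : ℝ) + 1 ≤ 4 * Real.log n := by
      have h4 : 1 / (n : ℝ) ^ 2 ≤ (1 / 2) ^ R :=
        (hη0.trans (le_mul_of_one_le_left hηpos.le (one_le_pow₀ (by norm_num)))).trans hR2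
      have h5 : (2 : ℝ) ^ R ≤ (n : ℝ) ^ 2 := by
        rw [one_div_pow] at h4
        exact (one_div_le_one_div (by positivity) (by positivity)).1 h4
      have h6 := Real.log_le_log (by positivity) h5
      rw [Real.log_pow, Real.log_pow] at h6
      push_cast at h6
      have h7 := hlog3 n hn3
      have h8 := Real.log_two_gt_d9
      have h9 : (0 : ℝ) ≤ R := by positivity
      nlinarith
    refine (measure_mono ?_).trans ((volume_prod_dn_lt_le k (show 0 < n by omega) R).trans
      (ENNReal.ofReal_le_ofReal ?_))
    · rintro α ⟨-, hα, hα1⟩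
      refine ⟨hα.trans_le (le_trans ?_ hR3), hα1⟩
      exact le_add_of_nonneg_right (by positivity)
    · calc ((R : ℝ) + 1) ^ k * (4 ^ (k + 1) * (1 / 2) ^ R)
          ≤ (4 * Real.log n) ^ k * (4 ^ (k + 1) * (2 * (2 ^ (k + 1) * η))) := by
            rw [pow_succ (1 / 2 : ℝ) R] at hR1
            gcongr
            linarith
        _ = g n := by
            rw [hg, hηdef, mul_pow]; ring
  have hBC := measure_setOfPred_frequently_eq_zero (μ := (volume : Measure (Fin (k + 1) → ℝ)))
    (p := fun n α => N ≤ n ∧ ∏ i, dn ((n : ℝ) * α i) < φ n ∧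
      α ∈ Set.Icc (0 : Fin (k + 1) → ℝ) 1)
    (ne_top_of_le_ne_top hgs.tsum_ofReal_ne_top (ENNReal.tsum_le_tsum hbound))
  refine measure_mono_null ?_ hBC
  rintro α ⟨hα, hα1⟩
  rw [Set.mem_ofPred_eq]
  have h1 := Nat.frequently_atTop_iff_infinite.2 hα
  refine (h1.and_eventually (eventually_ge_atTop N)).mono ?_
  rintro n ⟨⟨-, hlt⟩, hn⟩
  exact ⟨hn, hlt, hα1⟩

/-- Gallagher's theorem: for decreasing `ψ : ℕ → ℝ≥0`, the set
`W_k^×(ψ) ⊆ [0,1]^k` of `α` with `‖nα₁‖⋯‖nα_k‖ < ψ(n)` infinitely often has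
`k`-dimensional Lebesgue measure `0` if `∑ ψ(n)(log n)^{k-1}` converges, and `1` if it
diverges. -/
theorem gallagher (k : ℕ) (hk : 2 ≤ k) (ψ : ℕ → ℝ) (hψ0 : ∀ n, 0 ≤ ψ n)
    (hψmono : Antitone ψ) :
    (Summable (fun n : ℕ => ψ n * Real.log n ^ (k - 1)) →
      (volume : Measure (Fin k → ℝ))
        {α : Fin k → ℝ | (∀ i, α i ∈ Set.Icc (0 : ℝ) 1) ∧
          {n : ℕ | 0 < n ∧ ∏ i, dn ((n : ℝ) * α i) < ψ n}.Infinite} = 0) ∧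
    (¬ Summable (fun n : ℕ => ψ n * Real.log n ^ (k - 1)) →
      (volume : Measure (Fin k → ℝ))
        {α : Fin k → ℝ | (∀ i, α i ∈ Set.Icc (0 : ℝ) 1) ∧
          {n : ℕ | 0 < n ∧ ∏ i, dn ((n : ℝ) * α i) < ψ n}.Infinite} = 1) := by
  obtain ⟨k, rfl⟩ : ∃ m, k = m + 1 := ⟨k - 1, by omega⟩
  have hset : {α : Fin (k + 1) → ℝ | (∀ i, α i ∈ Set.Icc (0 : ℝ) 1) ∧
      {n : ℕ | 0 < n ∧ ∏ i, dn ((n : ℝ) * α i) < ψ n}.Infinite}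
      = multApprox (k + 1) ψ ∩ Set.Icc 0 1 := by
    ext α
    exact ⟨fun h => ⟨h.2, fun i => (h.1 i).1, fun i => (h.1 i).2⟩,
      fun h => ⟨fun i => ⟨h.2.1 i, h.2.2 i⟩, h.1⟩⟩
  rw [hset, Nat.add_sub_cancel]
  exact ⟨volume_multApprox_of_summable hψ0,
    volume_multApprox_of_not_summable (by omega) hψ0 hψmono⟩
end

section
/- (Bugeaud–Laurent) Let d ≥ 1 and let α, γ ∈ ℝ^d. If the dual exponent satisfies 0 < ω*(α) < ∞, then the uniform simultaneous inhomogeneous exponent satisfies ω̂(α, γ) ≥ 1/ω*(α). -/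
open scoped BigOperators
open Filter MeasureTheory

/-- Dual exponent `ω*(α)`: the supremum of the reals `w` such that
`‖n₁α₁ + ⋯ + n_dα_d‖ ≤ |n|^{-w}` for infinitely many nonzero `n ∈ ℤ^d`,
where `|n| = max_i |n_i|`. -/
noncomputable def dualExp {d : ℕ} (α : Fin d → ℝ) : EReal :=
  sSup {w : EReal | ∃ v : ℝ, w = (v : ℝ) ∧
    {n : Fin d → ℤ | n ≠ 0 ∧
      dn (∑ i, n i * α i) ≤ ((Finset.univ.sup fun i => (n i).natAbs : ℕ) : ℝ) ^ (-v)}.Infinite}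

/-- Uniform simultaneous inhomogeneous exponent `ω̂(α, γ)`. -/
noncomputable def unifExp {d : ℕ} (α γ : Fin d → ℝ) : EReal :=
  sSup {w : EReal | ∃ v : ℝ, w = (v : ℝ) ∧
    ∃ X0 : ℝ, ∀ X : ℝ, X0 ≤ X → ∃ n : ℕ, 0 < n ∧ (n : ℝ) < X ∧
      ∀ i, dn (n * α i - γ i) < X ^ (-v)}

/-- The additive character `θ ↦ exp(2πiθ)`. -/
noncomputable def addChar (θ : ℝ) : ℂ := Complex.exp (Complex.I * ((2 * Real.pi * θ : ℝ) : ℂ))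

lemma addChar_add (x y : ℝ) : addChar (x + y) = addChar x * addChar y := by
  rw [addChar, addChar, addChar, ← Complex.exp_add]
  push_cast
  ring_nf

lemma addChar_zero : addChar 0 = 1 := by simp [addChar]

lemma addChar_sum {ι : Type*} (s : Finset ι) (f : ι → ℝ) :
    addChar (∑ i ∈ s, f i) = ∏ i ∈ s, addChar (f i) := by
  classical
  induction s using Finset.induction_on with
  | empty => simp [addChar_zero]
  | insert a s ha ih => rw [Finset.sum_insert ha, Finset.prod_insert ha, addChar_add, ih]

lemma norm_addChar (x : ℝ) : ‖addChar x‖ = 1 := by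
  rw [addChar, mul_comm, Complex.norm_exp_ofReal_mul_I]

lemma conj_addChar (x : ℝ) : (starRingEnd ℂ) (addChar x) = addChar (-x) := by
  rw [addChar, addChar, ← Complex.exp_conj, map_mul, Complex.conj_I, Complex.conj_ofReal]
  push_cast
  ring_nf

lemma addChar_sub_intCast (x : ℝ) (n : ℤ) : addChar (x - n) = addChar x := by
  rw [addChar, addChar, Complex.exp_eq_exp_iff_exists_int]
  exact ⟨-n, by push_cast; ring⟩

lemma dn_le_norm_addChar_sub_one (x : ℝ) : 2 * dn x ≤ ‖addChar x - 1‖ := by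
  rw [← addChar_sub_intCast x (round x), addChar, Complex.norm_exp_I_mul_ofReal_sub_one, dn]
  set y := x - round x with hy
  have hy2 : |y| ≤ 1 / 2 := abs_sub_round x
  have hpi := Real.pi_pos
  have h := Real.mul_abs_le_abs_sin (x := Real.pi * y) (by
    rw [abs_mul, abs_of_pos hpi]; nlinarith)
  rw [abs_mul, abs_of_pos hpi] at h
  have h2 : 2 / Real.pi * (Real.pi * |y|) = 2 * |y| := by field_simp
  rw [h2] at h
  rw [norm_mul, Real.norm_eq_abs, Real.norm_eq_abs, abs_two,
    show 2 * Real.pi * y / 2 = Real.pi * y by ring]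
  linarith [abs_nonneg y]

/-- The exponential sum `∑_{1 ≤ j ≤ L} exp(2πijθ)`. -/
noncomputable def expSum (L : ℕ) (θ : ℝ) : ℂ := ∑ j : Fin L, addChar (((j : ℕ) + 1 : ℕ) * θ)

lemma norm_expSum_le (L : ℕ) (θ : ℝ) : ‖expSum L θ‖ ≤ L := by
  refine (norm_sum_le _ _).trans ?_
  simp [norm_addChar]

lemma norm_expSum_mul_dn_le (L : ℕ) (θ : ℝ) : ‖expSum L θ‖ * dn θ ≤ 1 := by
  have key : expSum L θ * (addChar θ - 1) = addChar ((L + 1 : ℕ) * θ) - addChar θ := by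
    have h : ∀ j : ℕ, addChar ((j + 1 : ℕ) * θ) * (addChar θ - 1) =
        addChar ((j + 1 + 1 : ℕ) * θ) - addChar ((j + 1 : ℕ) * θ) := by
      intro j
      rw [mul_sub, ← addChar_add, mul_one]
      congr 2
      push_cast
      ring
    rw [expSum, Finset.sum_mul, Finset.sum_congr rfl (fun (j : Fin L) _ => h j),
      Fin.sum_univ_eq_sum_range
        (fun j => addChar ((j + 1 + 1 : ℕ) * θ) - addChar ((j + 1 : ℕ) * θ)),
      Finset.sum_range_sub (fun j => addChar ((j + 1 : ℕ) * θ))]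
    simp
  have h1 : ‖expSum L θ‖ * ‖addChar θ - 1‖ ≤ 2 := by
    rw [← norm_mul, key]
    refine (norm_sub_le _ _).trans ?_
    rw [norm_addChar, norm_addChar]
    norm_num
  have := mul_le_mul_of_nonneg_left (dn_le_norm_addChar_sub_one θ) (norm_nonneg (expSum L θ))
  linarith

lemma expSum_zero (L : ℕ) : expSum L 0 = L := by
  simp [expSum, addChar_zero]

lemma expSum_pow (L k : ℕ) (θ : ℝ) :
    expSum L θ ^ k = ∑ t : Fin k → Fin L, addChar ((∑ q, ((t q : ℕ) + 1) : ℕ) * θ) := by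
  rw [expSum, Fintype.sum_pow]
  refine Finset.sum_congr rfl fun t _ => ?_
  rw [← addChar_sum]
  push_cast
  rw [Finset.sum_mul]

/-- The number of coincidences of a map into a set of given size, bounded by Cauchy–Schwarz. -/
lemma card_sq_le_card_mul_coincidences {U B : Type*} [Fintype U] [DecidableEq B]
    (f : U → B) (T : Finset B) (hf : ∀ u, f u ∈ T) :
    (Fintype.card U : ℝ) ^ 2 ≤ T.card * ∑ u, ∑ u', if f u = f u' then (1 : ℝ) else 0 := by
  have h1 : (Fintype.card U : ℝ) = ∑ b ∈ T, ∑ u, if f u = b then (1 : ℝ) else 0 := by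
    rw [Finset.sum_comm]
    simp [hf]
  have h2 : ∑ u, ∑ u', (if f u = f u' then (1 : ℝ) else 0) =
      ∑ b ∈ T, (∑ u, if f u = b then (1 : ℝ) else 0) ^ 2 := by
    simp_rw [sq, Finset.sum_mul_sum]
    rw [Finset.sum_comm]
    conv_rhs => rw [Finset.sum_comm]
    rw [Finset.sum_comm]
    refine Finset.sum_congr rfl fun u _ => ?_
    rw [Finset.sum_comm]
    refine Finset.sum_congr rfl fun u' _ => ?_
    simp [hf, eq_comm]
  rw [h1, h2]
  exact sq_sum_le_card_mul_sum_sq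

/-- Sums of `K` integers in `[1, J]`, one for each of the `d` coordinates. -/
def sumVec {d K J : ℕ} (u : Fin d → Fin K → Fin J) (i : Fin d) : ℕ := ∑ q, ((u i q : ℕ) + 1)

lemma sum_succ_le {K J : ℕ} (t : Fin K → Fin J) : ∑ q, ((t q : ℕ) + 1) ≤ K * J := by
  refine (Finset.sum_le_sum fun q _ => (Nat.succ_le_of_lt (t q).2)).trans ?_
  simp

lemma sum_succ_pos {K J : ℕ} (hK : 0 < K) (t : Fin K → Fin J) : 0 < ∑ q, ((t q : ℕ) + 1) := by
  have : Nonempty (Fin K) := ⟨⟨0, hK⟩⟩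
  exact Finset.sum_pos (fun q _ => Nat.succ_pos _) Finset.univ_nonempty

/-- The kernel `∏ᵢ expSum J xᵢ ^ K`, expanded as a trigonometric polynomial. -/
lemma prod_expSum_pow {d : ℕ} (J K : ℕ) (x : Fin d → ℝ) :
    ∏ i, expSum J (x i) ^ K =
      ∑ u : Fin d → Fin K → Fin J, addChar (∑ i, sumVec u i * x i) := by
  simp_rw [expSum_pow, Finset.prod_univ_sum, Fintype.piFinset_univ, addChar_sum, sumVec]

lemma norm_prod_expSum_pow_le {d : ℕ} {J K : ℕ} (hJ : 0 < J) {δ : ℝ} (hδ : 0 < δ)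
    (x : Fin d → ℝ) (hx : ∃ i, δ ≤ dn (x i)) :
    ‖∏ i, expSum J (x i) ^ K‖ ≤ (J : ℝ) ^ (K * d) * (1 / (δ * J)) ^ K := by
  obtain ⟨i, hi⟩ := hx
  have hJ' : (0 : ℝ) < J := by exact_mod_cast hJ
  have h1 : ∏ i, (‖expSum J (x i)‖ / J) ≤ 1 / (δ * J) := by
    rw [← Finset.mul_prod_erase _ _ (Finset.mem_univ i)]
    have h2 : ‖expSum J (x i)‖ / J ≤ 1 / (δ * J) := by
      rw [div_le_div_iff₀ hJ' (by positivity)]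
      have := norm_expSum_mul_dn_le J (x i)
      have := mul_le_mul_of_nonneg_left hi (norm_nonneg (expSum J (x i)))
      nlinarith
    refine (mul_le_of_le_one_right (by positivity) ?_).trans h2
    refine Finset.prod_le_one (fun _ _ => by positivity) fun j _ => ?_
    exact (div_le_one hJ').2 (norm_expSum_le _ _)
  have h3 : ‖∏ i, expSum J (x i) ^ K‖ =
      (J : ℝ) ^ (K * d) * (∏ i, (‖expSum J (x i)‖ / J)) ^ K := by
    rw [Finset.prod_div_distrib, div_pow, norm_prod]
    simp only [norm_pow, Finset.prod_pow, Finset.prod_const, Finset.card_univ, Fintype.card_fin]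
    rw [← pow_mul, mul_comm d K]
    field_simp
  rw [h3]
  gcongr

lemma sum_normSq_kernel {d : ℕ} (α γ : Fin d → ℝ) (J K L k : ℕ) :
    ((∑ t : Fin k → Fin L, ‖∏ i, expSum J
        ((∑ q, ((t q : ℕ) + 1) : ℕ) * α i - γ i) ^ K‖ ^ 2 : ℝ) : ℂ) =
      ∑ u : Fin d → Fin K → Fin J, ∑ u' : Fin d → Fin K → Fin J,
        addChar (-∑ i, ((sumVec u i : ℝ) - sumVec u' i) * γ i) *
          expSum L (∑ i, ((sumVec u i : ℝ) - sumVec u' i) * α i) ^ k := by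
  push_cast
  simp_rw [← Complex.mul_conj', prod_expSum_pow, map_sum, Finset.sum_mul_sum, conj_addChar,
    ← addChar_add]
  rw [Finset.sum_comm]
  refine Finset.sum_congr rfl fun u _ => ?_
  rw [Finset.sum_comm]
  refine Finset.sum_congr rfl fun u' _ => ?_
  rw [expSum_pow, Finset.mul_sum]
  refine Finset.sum_congr rfl fun t _ => ?_
  rw [← addChar_add, Finset.mul_sum, ← Finset.sum_neg_distrib, ← Finset.sum_neg_distrib,
    ← Finset.sum_add_distrib, ← Finset.sum_add_distrib]
  congr 1
  refine Finset.sum_congr rfl fun i _ => ?_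
  push_cast
  ring

/-- A quantitative transference inequality: if no `n ≤ kL` has `nα` within `δ` of `γ`, then
`(KJ)^{-d}` is small in terms of `δ` and the lower bound `η` for the dual linear forms. -/
lemma transference {d : ℕ} (α γ : Fin d → ℝ) {J K L k : ℕ} (hJ : 0 < J) (hK : 0 < K)
    (hL : 0 < L) (hk : 0 < k) {δ η : ℝ} (hδ : 0 < δ) (hη : 0 < η)
    (hdual : ∀ m : Fin d → ℤ, m ≠ 0 → (∀ i, (m i).natAbs ≤ K * J) →
      η ≤ dn (∑ i, m i * α i))
    (hfar : ∀ n : ℕ, 0 < n → n ≤ k * L → ∃ i, δ ≤ dn (n * α i - γ i)) :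
    1 / ((K * J : ℕ) : ℝ) ^ d ≤ (1 / (δ * J)) ^ (2 * K) + (1 / (η * L)) ^ k := by
  classical
  have hJ' : (0 : ℝ) < J := by exact_mod_cast hJ
  have hL' : (0 : ℝ) < L := by exact_mod_cast hL
  have hKJ : (0 : ℝ) < (K * J : ℕ) := by exact_mod_cast Nat.mul_pos hK hJ
  set U := Fin d → Fin K → Fin J
  have hU : (Fintype.card U : ℝ) = (J : ℝ) ^ (K * d) := by
    simp [U, pow_mul]
  set S : ℝ := ∑ t : Fin k → Fin L, ‖∏ i, expSum J
        ((∑ q, ((t q : ℕ) + 1) : ℕ) * α i - γ i) ^ K‖ ^ 2 with hS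
  set Z : ℝ := ∑ u : U, ∑ u' : U, if sumVec u = sumVec u' then (1 : ℝ) else 0 with hZ
  have upper : S ≤ L ^ k * ((J : ℝ) ^ (K * d) * (1 / (δ * J)) ^ K) ^ 2 := by
    have : ∀ t ∈ (Finset.univ : Finset (Fin k → Fin L)), ‖∏ i, expSum J
        ((∑ q, ((t q : ℕ) + 1) : ℕ) * α i - γ i) ^ K‖ ^ 2 ≤
          ((J : ℝ) ^ (K * d) * (1 / (δ * J)) ^ K) ^ 2 := fun t _ => by
      gcongr
      exact norm_prod_expSum_pow_le hJ hδ _ (hfar _ (sum_succ_pos hk t) (sum_succ_le t))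
    refine (Finset.sum_le_sum this).trans_eq ?_
    simp
  have hcount : (Fintype.card U : ℝ) ^ 2 ≤ ((K * J : ℕ) : ℝ) ^ d * Z := by
    have := card_sq_le_card_mul_coincidences (fun u : U => sumVec u)
      (Fintype.piFinset fun _ => Finset.Icc 1 (K * J)) (fun u => by
        simp only [Fintype.mem_piFinset, Finset.mem_Icc]
        exact fun i => ⟨sum_succ_pos hK _, sum_succ_le _⟩)
    rw [Fintype.card_piFinset_const, Nat.card_Icc, Nat.add_sub_cancel,
      Nat.cast_pow] at this
    exact this
  have lower : Z * L ^ k - (Fintype.card U : ℝ) ^ 2 * (1 / η) ^ k ≤ S := by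
    have h := congrArg Complex.re (sum_normSq_kernel α γ J K L k)
    rw [Complex.ofReal_re, Complex.re_sum] at h
    have hterm : ∀ u u' : U, (if sumVec u = sumVec u' then (1 : ℝ) else 0) * L ^ k - (1 / η) ^ k ≤
        (addChar (-∑ i, ((sumVec u i : ℝ) - sumVec u' i) * γ i) *
          expSum L (∑ i, ((sumVec u i : ℝ) - sumVec u' i) * α i) ^ k).re := by
      intro u u'
      split_ifs with huu
      · simp only [huu, sub_self, zero_mul, Finset.sum_const_zero, neg_zero, addChar_zero,
          expSum_zero, one_mul]
        rw [← Nat.cast_pow, ← Nat.cast_pow, Complex.natCast_re, sub_le_self_iff]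
        positivity
      · have hm : (fun i => (sumVec u i : ℤ) - sumVec u' i) ≠ 0 := fun h0 => huu <| by
          funext i
          have := congrFun h0 i
          simp only [Pi.zero_apply] at this
          omega
        have hη' := hdual _ hm fun i => by
          have h1 : sumVec u i ≤ K * J := sum_succ_le _
          have h2 : sumVec u' i ≤ K * J := sum_succ_le _
          omega
        push_cast at hη'
        set θ := ∑ i, ((sumVec u i : ℝ) - sumVec u' i) * α i
        have hD : ‖expSum L θ‖ ≤ 1 / η := by
          rw [le_div_iff₀ hη]
          exact (mul_le_mul_of_nonneg_left hη' (norm_nonneg _)).trans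
            (norm_expSum_mul_dn_le L θ)
        have hn : ‖addChar (-∑ i, ((sumVec u i : ℝ) - sumVec u' i) * γ i) * expSum L θ ^ k‖ ≤
            (1 / η) ^ k := by
          rw [norm_mul, norm_addChar, one_mul, norm_pow]
          gcongr
        have := (abs_le.1 (Complex.abs_re_le_norm
          (addChar (-∑ i, ((sumVec u i : ℝ) - sumVec u' i) * γ i) * expSum L θ ^ k))).1
        linarith
    rw [hS, h]
    simp_rw [Complex.re_sum]
    refine le_trans (le_of_eq ?_)
      (Finset.sum_le_sum fun u _ => Finset.sum_le_sum fun u' _ => hterm u u')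
    simp only [Finset.sum_sub_distrib, ← Finset.sum_mul, Finset.sum_const, Finset.card_univ,
      nsmul_eq_mul]
    ring
  rw [← hU] at upper
  set N : ℝ := (Fintype.card U : ℝ)
  have hN : 0 < N := by rw [hU]; positivity
  have h1 : 1 / ((K * J : ℕ) : ℝ) ^ d * (N ^ 2 * L ^ k) ≤ Z * L ^ k := by
    rw [div_mul_eq_mul_div, one_mul, div_le_iff₀ (by positivity)]
    nlinarith [mul_le_mul_of_nonneg_right hcount (pow_nonneg hL'.le k)]
  have h2 : ((1 / (δ * J)) ^ (2 * K) + (1 / (η * L)) ^ k) * (N ^ 2 * L ^ k) =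
      L ^ k * (N * (1 / (δ * J)) ^ K) ^ 2 + N ^ 2 * (1 / η) ^ k := by
    rw [← one_div_mul_one_div η, mul_pow (1 / η), mul_comm 2 K, pow_mul, one_div (L : ℝ), inv_pow]
    field_simp
  refine le_of_mul_le_mul_right ?_ (by positivity : 0 < N ^ 2 * (L : ℝ) ^ k)
  rw [h2]
  linarith

lemma exists_dual_lower_bound {d : ℕ} (α : Fin d → ℝ) {w : ℝ} (hw : 0 < w)
    (h : dualExp α < w) :
    ∃ c : ℝ, 0 < c ∧ ∀ H : ℕ, 0 < H → ∀ m : Fin d → ℤ, m ≠ 0 → (∀ i, (m i).natAbs ≤ H) →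
      c * (H : ℝ) ^ (-w) ≤ dn (∑ i, m i * α i) := by
  set E := {n : Fin d → ℤ | n ≠ 0 ∧ dn (∑ i, n i * α i) ≤
    ((Finset.univ.sup fun i => (n i).natAbs : ℕ) : ℝ) ^ (-w)} with hE
  have hfin : E.Finite := by
    by_contra hinf
    exact absurd (le_sSup ⟨w, rfl, hinf⟩ : (w : EReal) ≤ dualExp α) (not_le.2 h)
  have hpos : ∀ m : Fin d → ℤ, m ≠ 0 → 0 < dn (∑ i, m i * α i) := by
    intro m hm
    refine lt_of_le_of_ne (abs_nonneg _) fun h0 => ?_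
    have hint : (∑ i, m i * α i) = round (∑ i, m i * α i) := by
      rw [dn, eq_comm, abs_eq_zero, sub_eq_zero] at h0
      exact h0
    refine Set.infinite_of_injective_forall_mem (f := fun k : ℕ => ((k : ℤ) + 1) • m)
      (fun a b hab => ?_) (fun k => ?_) hfin
    · obtain ⟨i, hi⟩ := Function.ne_iff.1 hm
      have := congrFun hab i
      simp only [Pi.smul_apply, smul_eq_mul] at this
      have := mul_right_cancel₀ hi this
      omega
    · refine ⟨smul_ne_zero (by omega) hm, ?_⟩
      have : ∑ i, ((((k : ℤ) + 1) • m) i : ℝ) * α i =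
          ((((k : ℤ) + 1) * round (∑ i, m i * α i) : ℤ) : ℝ) := by
        rw [Int.cast_mul, ← hint, Finset.mul_sum]
        refine Finset.sum_congr rfl fun i _ => ?_
        simp [mul_assoc]
      rw [this, dn, round_intCast, sub_self, abs_zero]
      positivity
  obtain ⟨c, hc, hcE⟩ : ∃ c : ℝ, 0 < c ∧ ∀ m ∈ E, c ≤ dn (∑ i, m i * α i) := by
    rcases E.eq_empty_or_nonempty with h0 | hne
    · exact ⟨1, one_pos, by simp [h0]⟩
    · obtain ⟨m, hm, hmin⟩ := Set.exists_min_image E (fun m => dn (∑ i, m i * α i)) hfin hne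
      exact ⟨_, hpos m hm.1, hmin⟩
  refine ⟨min c 1, by positivity, fun H hH m hm hmH => ?_⟩
  have hH1 : (1 : ℝ) ≤ H := by exact_mod_cast hH
  by_cases hmE : m ∈ E
  · calc min c 1 * (H : ℝ) ^ (-w) ≤ c * 1 := by
          gcongr
          · exact min_le_left _ _
          · exact Real.rpow_le_one_of_one_le_of_nonpos hH1 (by linarith)
      _ ≤ _ := by rw [mul_one]; exact hcE m hmE
  · have hgt : ((Finset.univ.sup fun i => (m i).natAbs : ℕ) : ℝ) ^ (-w) <
        dn (∑ i, m i * α i) := by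
      by_contra hle
      exact hmE ⟨hm, not_lt.1 hle⟩
    refine le_trans ?_ hgt.le
    obtain ⟨i, hi⟩ := Function.ne_iff.1 hm
    have hs0 : 0 < Finset.univ.sup fun i => (m i).natAbs :=
      (Int.natAbs_pos.2 hi).trans_le
        (Finset.le_sup (f := fun i => (m i).natAbs) (Finset.mem_univ i))
    have hsH : (Finset.univ.sup fun i => (m i).natAbs) ≤ H := Finset.sup_le fun i _ => hmH i
    calc min c 1 * (H : ℝ) ^ (-w) ≤ 1 * (H : ℝ) ^ (-w) := by
          gcongr
          exact min_le_right _ _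
      _ ≤ _ := by
          rw [one_mul]
          exact Real.rpow_le_rpow_of_nonpos (by exact_mod_cast hs0) (by exact_mod_cast hsH)
            (by linarith)

/-- A lower bound of order `H^{-w}` for the dual linear forms gives uniform inhomogeneous
approximation to every order `v` smaller than some `b` with `b w < 1`. -/
lemma eventually_exists_approx {d : ℕ} (α γ : Fin d → ℝ) {v b w c : ℝ} (hc : 0 < c)
    (hw : 0 < w) (hb : 0 < b) (hvb : v < b) (hbw : b * w < 1)
    (hdual : ∀ H : ℕ, 0 < H → ∀ m : Fin d → ℤ, m ≠ 0 → (∀ i, (m i).natAbs ≤ H) →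
      c * (H : ℝ) ^ (-w) ≤ dn (∑ i, m i * α i)) :
    ∀ᶠ X : ℝ in atTop, ∃ n : ℕ, 0 < n ∧ (n : ℝ) < X ∧ ∀ i, dn (n * α i - γ i) < X ^ (-v) := by
  obtain ⟨K, hK⟩ := exists_nat_gt (max 0 (d * b / (2 * (b - v))))
  obtain ⟨k, hk⟩ := exists_nat_gt (max 0 (d * b / (1 - b * w)))
  have hK0 : 0 < K := by exact_mod_cast (le_max_left _ _).trans_lt hK
  have hk0 : 0 < k := by exact_mod_cast (le_max_left _ _).trans_lt hk
  have hK1 := (le_max_right _ _).trans_lt hK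
  have hk1 := (le_max_right _ _).trans_lt hk
  rw [div_lt_iff₀ (by linarith)] at hK1 hk1
  have hK0' : (0 : ℝ) < K := by exact_mod_cast hK0
  have hk0' : (0 : ℝ) < k := by exact_mod_cast hk0
  set C : ℝ := (2 * K) ^ w / c * (4 * k) with hC
  have hlim : Tendsto (fun X : ℝ => (2 * K : ℝ) ^ d * (X ^ (-(2 * K * (b - v) - d * b)) +
      C ^ k * X ^ (-(k * (1 - b * w) - d * b)))) atTop (nhds 0) := by
    have h1 := tendsto_rpow_neg_atTop (y := 2 * K * (b - v) - d * b) (by linarith)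
    have h2 := tendsto_rpow_neg_atTop (y := k * (1 - b * w) - d * b) (by linarith)
    simpa using (h1.add (h2.const_mul (C ^ k))).const_mul ((2 * K : ℝ) ^ d)
  filter_upwards [hlim.eventually_lt_const one_pos, eventually_ge_atTop (1 : ℝ),
    eventually_ge_atTop (2 * k : ℝ)] with X hX hX1 hXk
  by_contra! hno
  have hX0 : 0 < X := by linarith
  set J := ⌈X ^ b⌉₊
  set L := ⌊X / (2 * k)⌋₊
  have hXb : 1 ≤ X ^ b := Real.one_le_rpow hX1 hb.le
  have hJ1 : X ^ b ≤ J := Nat.le_ceil _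
  have hJ2 : (J : ℝ) ≤ 2 * X ^ b := by
    have := Nat.ceil_lt_add_one (zero_le_one.trans hXb)
    linarith
  have hJ0 : 0 < J := Nat.ceil_pos.2 (by linarith)
  have hq : 1 ≤ X / (2 * k) := by rwa [le_div_iff₀ (by positivity), one_mul]
  have hL0 : 0 < L := Nat.floor_pos.2 hq
  have hL0' : (1 : ℝ) ≤ L := by exact_mod_cast hL0
  have hL1 : (L : ℝ) ≤ X / (2 * k) := Nat.floor_le (by positivity)
  have hL2 : X / (4 * k) ≤ L := by
    have h1 := Nat.lt_floor_add_one (X / (2 * k))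
    have h2 : X / (4 * k) = X / (2 * k) / 2 := by field_simp; norm_num
    rw [h2]
    change X / (2 * k) < L + 1 at h1
    linarith
  have hKJ0 : 0 < K * J := Nat.mul_pos hK0 hJ0
  have hKJ0' : (0 : ℝ) < (K * J : ℕ) := by exact_mod_cast hKJ0
  have hKJ : ((K * J : ℕ) : ℝ) ≤ 2 * K * X ^ b := by
    push_cast
    nlinarith
  have key := transference α γ hJ0 hK0 hL0 hk0 (δ := X ^ (-v))
    (η := c * ((K * J : ℕ) : ℝ) ^ (-w)) (by positivity) (by positivity)
    (hdual _ hKJ0) (fun n hn hnL => hno n hn (by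
      have : (n : ℝ) ≤ k * L := by exact_mod_cast hnL
      have h2 : k * (X / (2 * k)) = X / 2 := by field_simp
      nlinarith))
  have e0 : 1 / ((2 * K : ℝ) ^ d * X ^ (d * b)) ≤ 1 / ((K * J : ℕ) : ℝ) ^ d := by
    rw [mul_comm (d : ℝ) b, Real.rpow_mul_natCast hX0.le, ← mul_pow]
    gcongr
  have e1 : (1 / (X ^ (-v) * J)) ^ (2 * K) ≤ X ^ (-(2 * K * (b - v))) := by
    have h1 : X ^ (-(2 * K * (b - v))) = (1 / (X ^ (-v) * X ^ b)) ^ (2 * K) := by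
      rw [← Real.rpow_add hX0, one_div, ← Real.rpow_neg hX0.le, ← Real.rpow_mul_natCast hX0.le]
      push_cast
      ring_nf
    rw [h1]
    gcongr
  have e2 : (1 / (c * ((K * J : ℕ) : ℝ) ^ (-w) * L)) ^ k ≤ C ^ k * X ^ (-(k * (1 - b * w))) := by
    have h1 : X ^ (-(k * (1 - b * w))) = (X ^ (b * w) / X) ^ k := by
      rw [← Real.rpow_sub_one hX0.ne', ← Real.rpow_mul_natCast hX0.le]
      ring_nf
    rw [h1, ← mul_pow]
    refine pow_le_pow_left₀ (by positivity) ?_ _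
    calc 1 / (c * ((K * J : ℕ) : ℝ) ^ (-w) * L) = ((K * J : ℕ) : ℝ) ^ w / (c * L) := by
          rw [Real.rpow_neg hKJ0'.le]
          field_simp
      _ ≤ (2 * K * X ^ b) ^ w / (c * (X / (4 * k))) := by gcongr
      _ = C * (X ^ (b * w) / X) := by
          rw [hC, Real.mul_rpow (by positivity) (by positivity), Real.rpow_mul hX0.le]
          field_simp
  have total := e0.trans (key.trans (add_le_add e1 e2))
  rw [div_le_iff₀ (by positivity)] at total
  refine absurd total (not_le.2 (lt_of_eq_of_lt ?_ hX))
  rw [neg_sub, neg_sub, sub_eq_add_neg (d * b), sub_eq_add_neg (d * b), Real.rpow_add hX0,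
    Real.rpow_add hX0]
  ring

/-- Bugeaud–Laurent transference: if `0 < ω*(α) < ∞` then `ω̂(α, γ) ≥ 1/ω*(α)`. -/
theorem bugeaud_laurent (d : ℕ) (hd : 1 ≤ d) (α γ : Fin d → ℝ)
    (h0 : 0 < dualExp α) (htop : dualExp α < ⊤) :
    (dualExp α)⁻¹ ≤ unifExp α γ := by
  obtain ⟨ω, hω⟩ : ∃ ω : ℝ, dualExp α = ω :=
    ⟨_, (EReal.coe_toReal htop.ne (ne_bot_of_gt h0)).symm⟩
  have hω0 : 0 < ω := by rw [hω] at h0; exact_mod_cast h0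
  rw [hω, ← EReal.coe_inv]
  refine EReal.ge_of_forall_gt_iff_ge.1 fun v hv => ?_
  rw [EReal.coe_lt_coe_iff] at hv
  obtain ⟨u, hu, huω⟩ := exists_between (max_lt hv (inv_pos.2 hω0))
  obtain ⟨b, hb, hbu⟩ := exists_between hu
  have hb0 : 0 < b := (le_max_right _ _).trans_lt hb
  have hu0 : 0 < u := hb0.trans hbu
  obtain ⟨c, hc, hdual⟩ := exists_dual_lower_bound α (inv_pos.2 hu0) (by
    rw [hω, EReal.coe_lt_coe_iff]
    exact (lt_inv_comm₀ hω0 hu0).2 huω)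
  obtain ⟨X₀, hX₀⟩ := eventually_atTop.1 <| eventually_exists_approx α γ hc (inv_pos.2 hu0) hb0
    ((le_max_left _ _).trans_lt hb) ((mul_inv_lt_iff₀ hu0).2 (by rwa [one_mul])) hdual
  exact le_sSup ⟨v, rfl, X₀, hX₀⟩
end

section
/- (Duffin–Schaeffer theorem) Let Φ : ℕ → ℝ_{≥0} satisfy Σ_{n=1}^∞ (φ(n)/n) Φ(n) = ∞ and limsup_{N→∞} (Σ_{n ≤ N} (φ(n)/n) Φ(n)) / (Σ_{n ≤ N} Φ(n)) > 0. Then for Lebesgue-almost all β ∈ ℝ there exist infinitely many pairs (n, r) ∈ ℕ × ℤ with gcd(n, r) = 1 and |nβ − r| < Φ(n). -/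
open scoped BigOperators
open Filter MeasureTheory

/-- The number of pairs of distinct reduced fractions with denominators `m ≠ n` at distance less
than `δ` on the unit circle is at most `2 m n δ`. -/
theorem card_close_reduced_fractions_le_s19 {m n : ℕ} (hm : 0 < m) (hn : 0 < n) (hmn : m ≠ n)
    {δ : ℝ} (hδ : 0 ≤ δ) :
    (((Finset.range m ×ˢ Finset.range n).filter fun p : ℕ × ℕ =>
      p.1.Coprime m ∧ p.2.Coprime n ∧
        ‖(((p.1 : ℝ) / m - (p.2 : ℝ) / n : ℝ) : UnitAddCircle)‖ < δ).card : ℝ) ≤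
      2 * m * n * δ := by
  obtain ⟨g, a, b, hg, hab, rfl, rfl⟩ := Nat.exists_coprime' (m := m) (n := n)
    (Nat.gcd_pos_of_pos_left n hm)
  have ha : 0 < a := Nat.pos_of_mul_pos_right hm
  have hb : 0 < b := Nat.pos_of_mul_pos_right hn
  have habZ : IsCoprime (a : ℤ) (b : ℤ) := Nat.isCoprime_iff_coprime.mpr hab
  let X : ℝ := g * a * b * δ
  have hX : 0 ≤ X := by positivity
  let t : ℕ × ℕ → ℤ := fun p =>
    p.1 * b - p.2 * a - (a * g) * b * round ((p.1 : ℝ) / (a * g : ℕ) - (p.2 : ℝ) / (b * g : ℕ))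
  have key : ∀ p : ℕ × ℕ, |(t p : ℝ)| = (g * a * b : ℝ) *
      ‖(((p.1 : ℝ) / (a * g : ℕ) - (p.2 : ℝ) / (b * g : ℕ) : ℝ) : UnitAddCircle)‖ := by
    intro p
    rw [UnitAddCircle.norm_eq, ← abs_of_nonneg (show (0 : ℝ) ≤ g * a * b by positivity), ← abs_mul]
    congr 1
    simp only [t]
    push_cast
    have : (g : ℝ) ≠ 0 := by positivity
    have : (a : ℝ) ≠ 0 := by positivity
    have : (b : ℝ) ≠ 0 := by positivity
    field_simp
  have hcard := Finset.card_le_card_of_injOn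
    (s := (Finset.range (a * g) ×ˢ Finset.range (b * g)).filter fun p : ℕ × ℕ =>
      p.1.Coprime (a * g) ∧ p.2.Coprime (b * g) ∧
        ‖(((p.1 : ℝ) / (a * g : ℕ) - (p.2 : ℝ) / (b * g : ℕ) : ℝ) : UnitAddCircle)‖ < δ)
    (t := ((Finset.Icc (-⌊X⌋) ⌊X⌋).erase 0) ×ˢ Finset.range g)
    (fun p => (t p, p.1 / a)) ?_ ?_
  · have hc : ((Finset.Icc (-⌊X⌋) ⌊X⌋).erase 0).card = 2 * ⌊X⌋.toNat := by
      have := Int.floor_nonneg.mpr hX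
      rw [Finset.card_erase_of_mem (by simpa using this), Int.card_Icc]
      lia
    rw [Finset.card_product, hc, Finset.card_range] at hcard
    have hf : ((⌊X⌋.toNat : ℕ) : ℝ) ≤ X := by
      have h0 : ((⌊X⌋.toNat : ℤ) : ℝ) = ⌊X⌋ := by
        rw [Int.toNat_of_nonneg (Int.floor_nonneg.mpr hX)]
      rw [← Int.cast_natCast, h0]
      exact Int.floor_le X
    refine (Nat.cast_le.mpr hcard).trans ?_
    push_cast
    calc (2 * (⌊X⌋.toNat : ℝ) * g) ≤ 2 * X * g := by gcongr
      _ = _ := by simp only [X]; ring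
  · intro p hp
    simp only [Finset.coe_filter, Finset.mem_product, Finset.mem_range, Set.mem_ofPred_eq] at hp
    obtain ⟨⟨h1, h2⟩, c1, c2, h3⟩ := hp
    simp only [Finset.coe_product, Set.mem_prod, Finset.mem_coe, Finset.mem_erase, Finset.mem_Icc,
      Finset.mem_range]
    refine ⟨⟨fun h0 => hmn ?_, ?_⟩, Nat.div_lt_of_lt_mul h1⟩
    · have e1 : (a : ℤ) ∣ p.1 * b := by
        refine ⟨p.2 + g * b * round ((p.1 : ℝ) / (a * g : ℕ) - (p.2 : ℝ) / (b * g : ℕ)), ?_⟩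
        simp only [t] at h0
        linear_combination h0
      have e2 : (b : ℤ) ∣ p.2 * a := by
        refine ⟨p.1 - g * a * round ((p.1 : ℝ) / (a * g : ℕ) - (p.2 : ℝ) / (b * g : ℕ)), ?_⟩
        simp only [t] at h0
        linear_combination -h0
      have e1 := Int.natCast_dvd_natCast.mp (habZ.dvd_of_dvd_mul_right e1)
      have e2 := Int.natCast_dvd_natCast.mp (habZ.symm.dvd_of_dvd_mul_right e2)
      rw [Nat.eq_one_of_dvd_coprimes c1 e1 (Dvd.intro g rfl),
        Nat.eq_one_of_dvd_coprimes c2 e2 (Dvd.intro g rfl)]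
    · have : |(t p : ℝ)| ≤ X := by
        rw [key]
        exact mul_le_mul_of_nonneg_left h3.le (by positivity)
      rw [abs_le] at this
      refine ⟨?_, Int.le_floor.mpr this.2⟩
      have := Int.le_floor.mpr (show ((-t p : ℤ) : ℝ) ≤ X by push_cast; linarith)
      linarith
  · intro p hp q hq hpq
    simp only [Finset.coe_filter, Finset.mem_product, Finset.mem_range, Set.mem_ofPred_eq] at hp hq
    simp only [Prod.mk.injEq] at hpq
    obtain ⟨ht, hd⟩ := hpq
    simp only [t] at ht
    generalize round ((p.1 : ℝ) / (a * g : ℕ) - (p.2 : ℝ) / (b * g : ℕ)) = i at ht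
    generalize round ((q.1 : ℝ) / (a * g : ℕ) - (q.2 : ℝ) / (b * g : ℕ)) = j at ht
    have e1 : (a : ℤ) ∣ (q.1 - p.1) * b :=
      ⟨q.2 - p.2 + g * b * (j - i), by linear_combination -ht⟩
    have e1 : p.1 ≡ q.1 [MOD a] :=
      (Nat.modEq_iff_dvd).mpr (habZ.dvd_of_dvd_mul_right e1)
    have h1 : p.1 = q.1 := by
      rw [← Nat.div_add_mod p.1 a, ← Nat.div_add_mod q.1 a, hd, e1]
    have e2 : p.2 ≡ q.2 [MOD (b * g)] := by
      refine Nat.modEq_iff_dvd.mpr ⟨i - j, ?_⟩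
      rw [h1] at ht
      have : (a : ℤ) ≠ 0 := by exact_mod_cast ha.ne'
      apply mul_left_cancel₀ this
      push_cast
      linear_combination ht
    exact Prod.ext h1 (e2.eq_of_lt_of_lt hp.1.2 hq.1.2)

/-- A form of the **Kochen–Stone lemma**. -/
theorem measure_limsup_pos_of_sum_measure_inter_le {Ω : Type*} [MeasurableSpace Ω]
    {μ : Measure Ω} [IsProbabilityMeasure μ] {E : ℕ → Set Ω} (hE : ∀ n, MeasurableSet (E n))
    (hdiv : Tendsto (fun N => ∑ n ∈ Finset.range N, μ.real (E n)) atTop atTop)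
    {C : ℝ} (hC : 0 < C)
    (hquad : ∀ᶠ N in atTop, ∑ m ∈ Finset.range N, ∑ n ∈ Finset.range N, μ.real (E m ∩ E n) ≤
      C * (∑ n ∈ Finset.range N, μ.real (E n)) ^ 2) :
    0 < μ (limsup E atTop) := by
  set S : ℕ → ℝ := fun N => ∑ n ∈ Finset.range N, μ.real (E n) with hS
  let f : ℕ → Ω → ℝ := fun N x => ∑ n ∈ Finset.range N, (E n).indicator 1 x
  have hind : ∀ {B : Set Ω}, MeasurableSet B → Integrable (B.indicator (1 : Ω → ℝ)) μ := fun hB =>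
    (integrable_const (1 : ℝ)).indicator hB
  have hfm : ∀ N, Measurable (f N) := fun N =>
    Finset.measurable_sum _ fun n _ => measurable_one.indicator (hE n)
  have hfi : ∀ N, Integrable (f N) μ := fun N =>
    integrable_finsetSum _ fun n _ => hind (hE n)
  have hf1 : ∀ N, ∫ x, f N x ∂μ = S N := by
    intro N
    simp only [f]
    rw [integral_finsetSum _ fun n _ => hind (hE n)]
    exact Finset.sum_congr rfl fun n _ => integral_indicator_one (hE n)
  have hsq : ∀ N x, f N x ^ 2 =
      ∑ m ∈ Finset.range N, ∑ n ∈ Finset.range N, (E m ∩ E n).indicator (1 : Ω → ℝ) x := by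
    intro N x
    simp only [f, sq, Finset.sum_mul_sum, Set.inter_indicator_one, Pi.mul_apply]
  have hint : ∀ m n, Integrable ((E m ∩ E n).indicator (1 : Ω → ℝ)) μ := fun m n =>
    hind ((hE m).inter (hE n))
  have hf2i : ∀ N, Integrable (fun x => f N x ^ 2) μ := by
    intro N
    simp only [hsq]
    exact integrable_finsetSum _ fun m _ => integrable_finsetSum _ fun n _ => hint m n
  have hf2 : ∀ N, ∫ x, f N x ^ 2 ∂μ =
      ∑ m ∈ Finset.range N, ∑ n ∈ Finset.range N, μ.real (E m ∩ E n) := by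
    intro N
    simp only [hsq]
    rw [integral_finsetSum _ fun m _ => integrable_finsetSum _ fun n _ => hint m n]
    refine Finset.sum_congr rfl fun m _ => ?_
    rw [integral_finsetSum _ fun n _ => hint m n]
    exact Finset.sum_congr rfl fun n _ => integral_indicator_one ((hE m).inter (hE n))
  let A : ℕ → Set Ω := fun N => {x | S N / 2 ≤ f N x}
  have hA : ∀ N, MeasurableSet (A N) := fun N => measurableSet_le measurable_const (hfm N)
  have hAm : ∀ᶠ N in atTop, 1 / (4 * C) ≤ μ.real (A N) := by
    filter_upwards [hquad, hdiv.eventually_gt_atTop 0] with N hN hpos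
    have hpos : 0 < S N := hpos
    have i1 : Integrable (fun x => f N x ^ 2 * (1 / (4 * C * S N))) μ := (hf2i N).mul_const _
    have i2 : Integrable (fun x => S N / 2 + f N x ^ 2 * (1 / (4 * C * S N))) μ :=
      (integrable_const _).add i1
    have i3 : Integrable (fun x => (A N).indicator 1 x * (C * S N)) μ :=
      (hind (hA N)).mul_const _
    have hbound : ∫ x, f N x ∂μ ≤ ∫ x, (S N / 2 + f N x ^ 2 * (1 / (4 * C * S N)) +
        (A N).indicator 1 x * (C * S N)) ∂μ := by
      refine integral_mono (hfi N) (i2.add i3) fun x => ?_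
      have hCS : 0 < C * S N := by positivity
      by_cases hx : x ∈ A N
      · simp only [Set.indicator_of_mem hx, Pi.one_apply]
        have : f N x ^ 2 * (1 / (4 * C * S N)) + 1 * (C * S N) - f N x =
            (f N x - 2 * (C * S N)) ^ 2 / (4 * (C * S N)) := by
          field_simp
          ring
        have h2 : 0 ≤ (f N x - 2 * (C * S N)) ^ 2 / (4 * (C * S N)) := by positivity
        linarith
      · simp only [Set.indicator_of_notMem hx]
        have : f N x < S N / 2 := not_le.mp hx
        have h2 : 0 ≤ f N x ^ 2 * (1 / (4 * C * S N)) := by positivity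
        linarith
    rw [integral_add i2 i3, integral_add (integrable_const _) i1, integral_mul_const,
      integral_mul_const, hf1, hf2, integral_indicator_one (hA N)] at hbound
    simp only [integral_const, probReal_univ, one_smul] at hbound
    have h1 : (∑ m ∈ Finset.range N, ∑ n ∈ Finset.range N, μ.real (E m ∩ E n)) *
        (1 / (4 * C * S N)) ≤ S N / 4 := by
      calc _ ≤ C * S N ^ 2 * (1 / (4 * C * S N)) := by gcongr
        _ = S N / 4 := by field_simp
    have h2 : S N * (1 / 4) ≤ S N * (μ.real (A N) * C) := by linarith
    have h3 := le_of_mul_le_mul_left h2 hpos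
    rw [div_le_iff₀ (by positivity)]
    linarith
  have hsub : limsup A atTop ⊆ limsup E atTop := by
    intro x hx
    rw [mem_limsup_iff_frequently_mem] at hx ⊢
    by_contra hcon
    obtain ⟨M, hM⟩ := eventually_atTop.mp (not_frequently.mp hcon)
    have hle : ∀ N, f N x ≤ M := by
      intro N
      calc f N x ≤ ∑ n ∈ Finset.range N, if n < M then (1 : ℝ) else 0 := by
            refine Finset.sum_le_sum fun n _ => ?_
            split_ifs with h
            · exact Set.indicator_le_self' (fun _ _ => zero_le_one) x
            · rw [Set.indicator_of_notMem (hM n (not_lt.mp h))]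
        _ = (((Finset.range N).filter (· < M)).card : ℝ) := by simp
        _ ≤ ((Finset.range M).card : ℝ) := by
            gcongr
            intro n hn
            simpa using (Finset.mem_filter.mp hn).2
        _ = M := by simp
    obtain ⟨N, hN, hS'⟩ := (hx.and_eventually (hdiv.eventually_gt_atTop (2 * M : ℝ))).exists
    have hN : S N / 2 ≤ f N x := hN
    have hS' : 2 * (M : ℝ) < S N := hS'
    linarith [hle N]
  refine lt_of_lt_of_le ?_ (measure_mono hsub)
  have hlim : Tendsto (fun N => μ (⋃ i ≥ N, A i)) atTop (nhds (μ (limsup A atTop))) := by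
    rw [limsup_eq_iInf_iSup_of_nat]
    refine tendsto_measure_iInter_atTop
      (fun N => (MeasurableSet.biUnion (Set.to_countable _) fun i _ => hA i).nullMeasurableSet)
      (fun N M h => Set.biUnion_mono (fun i hi => le_trans h hi) fun _ _ => le_rfl)
      ⟨0, measure_ne_top _ _⟩
  have hge : ENNReal.ofReal (1 / (4 * C)) ≤ μ (limsup A atTop) := by
    refine ge_of_tendsto hlim ?_
    filter_upwards [hAm] with N hN
    refine le_trans ?_ (measure_mono (Set.subset_biUnion_of_mem (u := A) (le_refl N)))
    rw [← ofReal_measureReal]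
    exact ENNReal.ofReal_le_ofReal hN
  exact lt_of_lt_of_le (ENNReal.ofReal_pos.mpr (by positivity)) hge

theorem UnitAddCircle.volume_real_closedBall (x : UnitAddCircle) {ε : ℝ} (hε : 0 ≤ ε) :
    volume.real (Metric.closedBall x ε) = min 1 (2 * ε) := by
  rw [measureReal_def, AddCircle.volume_closedBall, ENNReal.toReal_ofReal (by positivity)]

theorem volume_real_approxAddOrderOf_inter_le {m n : ℕ} (hm : 0 < m) (hn : 0 < n) (hmn : m ≠ n)
    {ε η : ℝ} (hε : 0 ≤ ε) (hη : 0 ≤ η) :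
    volume.real (approxAddOrderOf UnitAddCircle m ε ∩ approxAddOrderOf UnitAddCircle n η) ≤
      8 * (m * ε) * (n * η) := by
  have hcard := card_close_reduced_fractions_le_s19 hm hn hmn (add_nonneg hε hη)
  set F := (Finset.range m ×ˢ Finset.range n).filter fun p : ℕ × ℕ =>
      p.1.Coprime m ∧ p.2.Coprime n ∧
        ‖(((p.1 : ℝ) / m - (p.2 : ℝ) / n : ℝ) : UnitAddCircle)‖ < ε + η with hF
  let B : ℕ × ℕ → Set UnitAddCircle := fun p =>
    Metric.closedBall (((p.1 : ℝ) / m : ℝ) : UnitAddCircle) ε ∩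
      Metric.closedBall (((p.2 : ℝ) / n : ℝ) : UnitAddCircle) η
  have hsub : approxAddOrderOf UnitAddCircle m ε ∩ approxAddOrderOf UnitAddCircle n η ⊆
      ⋃ p ∈ F, B p := by
    rintro x ⟨h1, h2⟩
    obtain ⟨r, hr, hrm, hxr⟩ := (UnitAddCircle.mem_approxAddOrderOf_iff hm).mp h1
    obtain ⟨s, hs, hsn, hxs⟩ := (UnitAddCircle.mem_approxAddOrderOf_iff hn).mp h2
    refine Set.mem_biUnion (x := (r, s)) ?_ ⟨?_, ?_⟩
    · simp only [hF, Finset.coe_filter, Finset.mem_product, Finset.mem_range, Set.mem_ofPred_eq]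
      refine ⟨⟨hr, hs⟩, hrm, hsn, ?_⟩
      rw [AddCircle.coe_sub, ← sub_sub_sub_cancel_left _ _ x, add_comm]
      exact (norm_sub_le _ _).trans_lt (add_lt_add hxs hxr)
    · rw [mem_closedBall_iff_norm]
      exact hxr.le
    · rw [mem_closedBall_iff_norm]
      exact hxs.le
  have hB : ∀ p, volume.real (B p) ≤ 2 * min ε η := by
    intro p
    rw [mul_min_of_nonneg _ _ zero_le_two, le_min_iff]
    refine ⟨(measureReal_mono Set.inter_subset_left).trans ?_,
      (measureReal_mono Set.inter_subset_right).trans ?_⟩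
    · rw [UnitAddCircle.volume_real_closedBall _ hε]
      exact min_le_right _ _
    · rw [UnitAddCircle.volume_real_closedBall _ hη]
      exact min_le_right _ _
  calc _ ≤ volume.real (⋃ p ∈ F, B p) := measureReal_mono hsub (measure_ne_top _ _)
    _ ≤ ∑ p ∈ F, volume.real (B p) := measureReal_biUnion_finset_le _ _
    _ ≤ F.card * (2 * min ε η) := by
      rw [← nsmul_eq_mul]
      exact Finset.sum_le_card_nsmul _ _ _ fun p _ => hB p
    _ ≤ (2 * m * n * (ε + η)) * (2 * min ε η) := by gcongr
    _ ≤ (2 * m * n * (2 * max ε η)) * (2 * min ε η) := by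
      gcongr
      linarith [le_max_left ε η, le_max_right ε η]
    _ = 8 * m * n * (max ε η * min ε η) := by ring
    _ = _ := by
      rw [max_mul_min]
      ring

theorem totient_mul_le_volume_real_approxAddOrderOf {n : ℕ} (hn : 0 < n) {ε : ℝ} (hε : 0 ≤ ε)
    (hεn : n * ε ≤ 1 / 2) :
    n.totient * ε ≤ volume.real (approxAddOrderOf UnitAddCircle n ε) := by
  rcases hε.eq_or_lt with rfl | hε'
  · simp
  have hn' : (0 : ℝ) < n := by positivity
  let F := (Finset.range n).filter fun r => n.Coprime r
  let B : ℕ → Set UnitAddCircle := fun r =>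
    Metric.closedBall (((r : ℝ) / n : ℝ) : UnitAddCircle) (ε / 2)
  have hsub : ⋃ r ∈ F, B r ⊆ approxAddOrderOf UnitAddCircle n ε := by
    refine Set.iUnion₂_subset fun r hr x hx => ?_
    simp only [F, Finset.mem_filter, Finset.mem_range] at hr
    refine (UnitAddCircle.mem_approxAddOrderOf_iff hn).mpr ⟨r, hr.1, hr.2.symm, ?_⟩
    exact (mem_closedBall_iff_norm.mp hx).trans_lt (half_lt_self hε')
  have hdisj : (F : Set ℕ).PairwiseDisjoint B := by
    intro r hr s hs hrs
    simp only [F, Finset.coe_filter, Finset.mem_range, Set.mem_ofPred_eq] at hr hs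
    refine Metric.closedBall_disjoint_closedBall ?_
    rw [add_halves, dist_eq_norm, ← AddCircle.coe_sub, UnitAddCircle.norm_eq]
    generalize round ((r : ℝ) / n - s / n) = j
    have h1 : ((r : ℝ) / n - s / n - j) = ((r - s - n * j : ℤ) : ℝ) / n := by
      push_cast
      field_simp
    have h2 : (r - s - n * j : ℤ) ≠ 0 := by
      intro h0
      refine hrs (Nat.ModEq.eq_of_lt_of_lt (Nat.modEq_iff_dvd.mpr ⟨-j, ?_⟩) hr.1 hs.1)
      linear_combination -h0
    have h3 : (1 : ℝ) ≤ |((r - s - n * j : ℤ) : ℝ)| := by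
      exact_mod_cast Int.one_le_abs h2
    rw [h1, abs_div, abs_of_pos hn', lt_div_iff₀ hn']
    linarith
  have hB : ∀ r, volume.real (B r) = ε := by
    intro r
    rw [UnitAddCircle.volume_real_closedBall _ (by positivity), mul_div_cancel₀ _ two_ne_zero]
    refine min_eq_right ?_
    have : (1 : ℝ) ≤ n := by exact_mod_cast hn
    nlinarith
  calc n.totient * ε = ∑ r ∈ F, volume.real (B r) := by
        simp only [hB, Finset.sum_const, nsmul_eq_mul, Nat.totient_eq_card_coprime, F]
    _ = volume.real (⋃ r ∈ F, B r) :=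
        (measureReal_biUnion_finset hdisj fun r _ => Metric.isClosed_closedBall.measurableSet).symm
    _ ≤ _ := measureReal_mono hsub

theorem ae_mem_addWellApproximable_of_not_summable {ψ : ℕ → ℝ} (h0 : ∀ n, 0 ≤ ψ n)
    (h1 : ∀ n, ψ n ≤ 1 / 2) {c : ℝ} (hc : 0 < c)
    (hψc : ∀ n, ψ n ≠ 0 → c ≤ (n.totient : ℝ) / n) (hψ : ¬ Summable ψ) :
    ∀ᵐ x, x ∈ addWellApproximable UnitAddCircle fun n => ψ n / n := by
  let E : ℕ → Set UnitAddCircle := fun n => approxAddOrderOf UnitAddCircle n (ψ n / n)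
  have hEm : ∀ n, MeasurableSet (E n) := fun n => Metric.isOpen_thickening.measurableSet
  have hE0 : E 0 = ∅ := by
    simp only [E, approxAddOrderOf]
    exact Metric.thickening_of_nonpos (by simp) _
  have hlow : ∀ n, c * ψ n ≤ volume.real (E n) := by
    intro n
    by_cases hz : ψ n = 0
    · simp [hz]
    have hcn := hψc n hz
    have hn : 0 < n := by
      rcases Nat.eq_zero_or_pos n with rfl | h
      · simp at hcn
        linarith
      · exact h
    have hn' : (0 : ℝ) < n := by positivity
    refine le_trans ?_ (totient_mul_le_volume_real_approxAddOrderOf hn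
      (div_nonneg (h0 n) hn'.le) ?_)
    · calc c * ψ n ≤ (n.totient : ℝ) / n * ψ n := mul_le_mul_of_nonneg_right hcn (h0 n)
        _ = _ := by ring
    · rw [mul_div_cancel₀ _ hn'.ne']
      exact h1 n
  have hup : ∀ m n, volume.real (E m ∩ E n) ≤
      (if m = n then volume.real (E m) else 0) + 8 * (ψ m * ψ n) := by
    intro m n
    have hp : 0 ≤ 8 * (ψ m * ψ n) := mul_nonneg (by norm_num) (mul_nonneg (h0 m) (h0 n))
    split_ifs with hmn
    · subst hmn
      rw [Set.inter_self]
      linarith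
    rcases Nat.eq_zero_or_pos m with rfl | hm
    · simpa [hE0] using hp
    rcases Nat.eq_zero_or_pos n with rfl | hn
    · simpa [hE0] using hp
    have hm' : (0 : ℝ) < m := by positivity
    have hn' : (0 : ℝ) < n := by positivity
    have := volume_real_approxAddOrderOf_inter_le hm hn hmn
      (div_nonneg (h0 m) hm'.le) (div_nonneg (h0 n) hn'.le)
    rw [mul_div_cancel₀ _ hm'.ne', mul_div_cancel₀ _ hn'.ne'] at this
    linarith
  have hsum : ∀ N, c * ∑ n ∈ Finset.range N, ψ n ≤ ∑ n ∈ Finset.range N, volume.real (E n) := by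
    intro N
    rw [Finset.mul_sum]
    exact Finset.sum_le_sum fun n _ => hlow n
  have hdiv : Tendsto (fun N => ∑ n ∈ Finset.range N, volume.real (E n)) atTop atTop :=
    tendsto_atTop_mono hsum
      (((not_summable_iff_tendsto_nat_atTop_of_nonneg h0).mp hψ).const_mul_atTop hc)
  have : IsProbabilityMeasure (volume : Measure UnitAddCircle) := ⟨UnitAddCircle.measure_univ⟩
  have hpos : 0 < volume (limsup E atTop) := by
    refine measure_limsup_pos_of_sum_measure_inter_le hEm hdiv
      (C := 1 + 8 / c ^ 2) (by positivity) ?_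
    filter_upwards [hdiv.eventually_ge_atTop 1] with N hN
    set S := ∑ n ∈ Finset.range N, volume.real (E n)
    have hT : 0 ≤ ∑ n ∈ Finset.range N, ψ n := Finset.sum_nonneg fun n _ => h0 n
    calc _ ≤ ∑ m ∈ Finset.range N, ∑ n ∈ Finset.range N,
          ((if m = n then volume.real (E m) else 0) + 8 * (ψ m * ψ n)) :=
        Finset.sum_le_sum fun m _ => Finset.sum_le_sum fun n _ => hup m n
      _ = S + 8 * (∑ n ∈ Finset.range N, ψ n) ^ 2 := by
        simp only [Finset.sum_add_distrib, ← Finset.mul_sum, sq, Finset.sum_mul_sum]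
        congr 1
        refine Finset.sum_congr rfl fun m hm => ?_
        rw [Finset.sum_ite_eq, if_pos hm]
      _ = S + 8 / c ^ 2 * (c * ∑ n ∈ Finset.range N, ψ n) ^ 2 := by
        field_simp
      _ ≤ S ^ 2 + 8 / c ^ 2 * S ^ 2 := by
        gcongr
        · nlinarith
        · exact hsum N
      _ = _ := by ring
  have hδ : Tendsto (fun n : ℕ => ψ n / n) atTop (nhds 0) := by
    refine squeeze_zero (fun n => div_nonneg (h0 n) n.cast_nonneg) (fun n => ?_)
      (tendsto_const_div_atTop_nhds_zero_nat (1 / 2))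
    gcongr
    exact h1 n
  refine (AddCircle.addWellApproximable_ae_empty_or_univ _ hδ).resolve_left fun h => ?_
  refine hpos.ne' (measure_mono_null (fun x hx => ?_) (ae_iff.mp h))
  simp only [not_not, Set.mem_ofPred_eq, UnitAddCircle.mem_addWellApproximable_iff]
  rw [mem_limsup_iff_frequently_mem, Nat.frequently_atTop_iff_infinite] at hx
  refine hx.mono fun n hxn => ?_
  rcases Nat.eq_zero_or_pos n with rfl | hn
  · simp [hE0] at hxn
  · exact (UnitAddCircle.mem_approxAddOrderOf_iff hn).mp hxn

theorem UnitAddCircle.ae_coe_of_ae {p : UnitAddCircle → Prop} (h : ∀ᵐ x, p x) :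
    ∀ᵐ β : ℝ, p β := by
  rw [← Measure.restrict_univ (μ := (volume : Measure ℝ)), ← iUnion_Ioc_intCast ℝ,
    ae_restrict_iUnion_iff]
  exact fun n => (UnitAddCircle.measurePreserving_mk n).quasiMeasurePreserving.ae h

theorem infinite_coprime_pairs_of_mem_addWellApproximable {Φ ψ : ℕ → ℝ} (hle : ∀ n, ψ n ≤ Φ n)
    {β : ℝ} (hβ : (β : UnitAddCircle) ∈ addWellApproximable UnitAddCircle fun n => ψ n / n) :
    {q : ℕ × ℤ | 0 < q.1 ∧ Int.gcd (q.1 : ℤ) q.2 = 1 ∧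
      |(q.1 : ℝ) * β - (q.2 : ℝ)| < Φ q.1}.Infinite := by
  rw [UnitAddCircle.mem_addWellApproximable_iff] at hβ
  refine Set.Infinite.of_image Prod.fst (hβ.mono ?_)
  rintro n ⟨m, hmn, hcop, hlt⟩
  have hn : 0 < n := by lia
  have hn' : (0 : ℝ) < n := by positivity
  rw [← AddCircle.coe_sub, UnitAddCircle.norm_eq] at hlt
  generalize round (β - (m : ℝ) / n) = j at hlt
  refine ⟨(n, m + n * j), ⟨hn, ?_, ?_⟩, rfl⟩
  · rw [Int.gcd_add_mul_left_right, Int.gcd_comm]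
    exact hcop
  · have : (n : ℝ) * β - ((m + n * j : ℤ) : ℝ) = n * (β - m / n - j) := by
      push_cast
      field_simp
      ring
    rw [this, abs_mul, abs_of_pos hn']
    rw [lt_div_iff₀' hn'] at hlt
    exact hlt.trans_le (hle n)

theorem not_summable_ite_of_frequently_lt {r Φ : ℕ → ℝ} (hr0 : ∀ n, 0 ≤ r n) (hr1 : ∀ n, r n ≤ 1)
    (hr : r 0 = 0) (hΦ0 : ∀ n, 0 ≤ Φ n) (hdiv : ¬ Summable fun n => r n * Φ n) {c : ℝ}
    (hc : 0 < c)
    (hfreq : ∃ᶠ N in atTop,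
      c < (∑ n ∈ Finset.Icc 1 N, r n * Φ n) / ∑ n ∈ Finset.Icc 1 N, Φ n) :
    ¬ Summable fun n => if c / 2 ≤ r n then Φ n else 0 := by
  intro hs
  have hψ0 : ∀ n, 0 ≤ if c / 2 ≤ r n then Φ n else 0 := fun n => by
    split_ifs
    exacts [hΦ0 n, le_rfl]
  set M := ∑' n, if c / 2 ≤ r n then Φ n else 0
  have hrange : ∀ N, ∑ n ∈ Finset.Icc 1 N, r n * Φ n = ∑ n ∈ Finset.range (N + 1), r n * Φ n := by
    intro N
    refine Finset.sum_subset (fun n hn => ?_) fun n hn hn' => ?_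
    · simp only [Finset.mem_Icc, Finset.mem_range] at hn ⊢
      lia
    · simp only [Finset.mem_Icc, Finset.mem_range] at hn hn'
      obtain rfl : n = 0 := by lia
      simp [hr]
  have hT : Tendsto (fun N => ∑ n ∈ Finset.Icc 1 N, r n * Φ n) atTop atTop := by
    simp only [hrange]
    exact (tendsto_add_atTop_iff_nat 1).mpr ((not_summable_iff_tendsto_nat_atTop_of_nonneg
      fun n => mul_nonneg (hr0 n) (hΦ0 n)).mp hdiv)
  obtain ⟨N, hN, hNM⟩ := (hfreq.and_eventually (hT.eventually_gt_atTop (2 * M))).exists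
  have hD : 0 < ∑ n ∈ Finset.Icc 1 N, Φ n := by
    refine (Finset.sum_nonneg fun n _ => hΦ0 n).lt_of_ne fun h => ?_
    rw [← h, div_zero] at hN
    exact hN.not_gt hc
  rw [lt_div_iff₀ hD] at hN
  have hle : ∑ n ∈ Finset.Icc 1 N, r n * Φ n ≤ M + c / 2 * ∑ n ∈ Finset.Icc 1 N, Φ n := by
    calc _ ≤ ∑ n ∈ Finset.Icc 1 N, ((if c / 2 ≤ r n then Φ n else 0) + c / 2 * Φ n) := by
          refine Finset.sum_le_sum fun n _ => ?_
          split_ifs with h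
          · have := mul_le_mul_of_nonneg_right (hr1 n) (hΦ0 n)
            have := mul_nonneg hc.le (hΦ0 n)
            linarith
          · have := mul_le_mul_of_nonneg_right (not_le.mp h).le (hΦ0 n)
            linarith
      _ = (∑ n ∈ Finset.Icc 1 N, if c / 2 ≤ r n then Φ n else 0) +
          c / 2 * ∑ n ∈ Finset.Icc 1 N, Φ n := by
        rw [Finset.sum_add_distrib, Finset.mul_sum]
      _ ≤ _ := by
        gcongr
        exact hs.sum_le_tsum _ fun n _ => hψ0 n
  linarith

theorem not_summable_min_of_not_summable {f : ℕ → ℝ} (hf : ¬ Summable f) {a : ℝ} (ha : 0 < a) :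
    ¬ Summable fun n => min (f n) a := by
  intro hs
  have hev := hs.tendsto_atTop_zero.eventually_lt_const ha
  refine hf (hs.congr_atTop ?_)
  filter_upwards [hev] with n hn
  exact min_eq_left ((min_lt_iff.mp hn).resolve_right (lt_irrefl a)).le

/-- The Duffin–Schaeffer theorem: if `Φ : ℕ → ℝ≥0` satisfies
`∑ (φ(n)/n) Φ(n) = ∞` and
`limsup_N (∑_{n ≤ N} (φ(n)/n) Φ(n)) / (∑_{n ≤ N} Φ(n)) > 0`, then for almost all
`β ∈ ℝ` there are infinitely many coprime pairs `(n, r) ∈ ℕ × ℤ` with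
`|nβ - r| < Φ(n)`. -/
theorem duffin_schaeffer (Φ : ℕ → ℝ) (hΦ0 : ∀ n, 0 ≤ Φ n)
    (hdiv : ¬ Summable (fun n : ℕ => ((Nat.totient n : ℝ) / n) * Φ n))
    (hlimsup : 0 < Filter.limsup
      (fun N : ℕ => (∑ n ∈ Finset.Icc 1 N, ((Nat.totient n : ℝ) / n) * Φ n) /
        (∑ n ∈ Finset.Icc 1 N, Φ n)) Filter.atTop) :
    ∀ᵐ β : ℝ ∂(volume : Measure ℝ),
      {q : ℕ × ℤ | 0 < q.1 ∧ Int.gcd (q.1 : ℤ) q.2 = 1 ∧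
        |(q.1 : ℝ) * β - (q.2 : ℝ)| < Φ q.1}.Infinite := by
  have hr0 : ∀ n : ℕ, 0 ≤ (n.totient : ℝ) / n := fun n => by positivity
  have hr1 : ∀ n : ℕ, (n.totient : ℝ) / n ≤ 1 := fun n =>
    div_le_one_of_le₀ (by exact_mod_cast n.totient_le) n.cast_nonneg
  obtain ⟨c, hc, hcL⟩ := exists_between hlimsup
  have hfreq := frequently_lt_of_lt_limsup (isCoboundedUnder_le_of_le atTop (x := 0) fun N =>
    div_nonneg (Finset.sum_nonneg fun n _ => mul_nonneg (hr0 n) (hΦ0 n))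
      (Finset.sum_nonneg fun n _ => hΦ0 n)) hcL
  have hns := not_summable_min_of_not_summable
    (not_summable_ite_of_frequently_lt hr0 hr1 (by simp) hΦ0 hdiv hc hfreq) one_half_pos
  have hae := ae_mem_addWellApproximable_of_not_summable (fun n => ?_) (fun n => min_le_right _ _)
    (half_pos hc) (fun n hn => ?_) hns
  · filter_upwards [UnitAddCircle.ae_coe_of_ae hae] with β hβ
    refine infinite_coprime_pairs_of_mem_addWellApproximable (fun n => ?_) hβ
    refine (min_le_left _ _).trans ?_
    split_ifs
    exacts [le_rfl, hΦ0 n]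
  · split_ifs
    exacts [le_min (hΦ0 n) (by norm_num), by norm_num]
  · by_contra h
    simp [if_neg h] at hn
end
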